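/- Let V ⊆ S^5 be a cube tiling code, let Q be a simple component of V, and let U(Q) be the simple cube tiling code containing Q. Then it is possible to pass from V to U(Q) by gluing and cutting keeping Q fixed throughout the sequence of operations. -/

import Mathlib

/- Common framework: polybox codes over a finite alphabet `S` with a
complementation `c : S → S` (an involution without fixed points). -/

namespace PolyboxPaper

variable {S : Type} [Fintype S] [DecidableEq S] {d : ℕ}

/-- Two words are dichotomous: they differ by complementation at some position. -/
def Dich (c : S → S) (v w : Fin d → S) : Prop := ∃ i, v i = c (w i)

instance (c : S → S) (v w : Fin d → S) : Decidable (Dich c v w) :=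
  decidable_of_iff (∃ i, v i = c (w i)) Iff.rfl

/-- A polybox code: every two distinct words are dichotomous. -/
def IsCode (c : S → S) (V : Finset (Fin d → S)) : Prop :=
  ∀ v ∈ V, ∀ w ∈ V, v ≠ w → Dich c v w

/-- A cube tiling code: a polybox code with `2 ^ d` words. -/
def CubeTiling (c : S → S) (V : Finset (Fin d → S)) : Prop :=
  IsCode c V ∧ V.card = 2 ^ d

/-- `v` and `w` form a twin pair in the `i`-th direction. -/
def TwinPair (c : S → S) (v w : Fin d → S) (i : Fin d) : Prop :=
  v i = c (w i) ∧ ∀ j, j ≠ i → v j = w j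

/-- A code is twin pair free if no two of its words form a twin pair. -/
def TwinPairFree (c : S → S) (V : Finset (Fin d → S)) : Prop :=
  ∀ v ∈ V, ∀ w ∈ V, ∀ i, ¬ TwinPair c v w i

/-- A single glue-and-cut operation: a twin pair `v, w` of `V` in the `i`-th
direction is replaced by a twin pair `q, t` in the `i`-th direction agreeing
with `v` (and `w`) at all positions `j ≠ i`. -/
def GCStep (c : S → S) (V W : Finset (Fin d → S)) : Prop :=
  ∃ (v w q t : Fin d → S) (i : Fin d), v ∈ V ∧ w ∈ V ∧ TwinPair c v w i ∧
    TwinPair c q t i ∧ (∀ j, j ≠ i → q j = v j) ∧ W = (V \ {v, w}) ∪ {q, t}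

/-- `W` is obtained from `V` by gluing and cutting (finite, possibly empty,
sequence of single glue-and-cut operations); equivalently, `V` and `W` are
strongly equivalent. -/
def GC (c : S → S) (V W : Finset (Fin d → S)) : Prop :=
  Relation.ReflTransGen (GCStep c) V W

/-- Passing from `V` to `W` by gluing and cutting keeping `Q` fixed:
every intermediate code contains `Q`. -/
def GCFix (c : S → S) (Q V W : Finset (Fin d → S)) : Prop :=
  Relation.ReflTransGen (fun A B => GCStep c A B ∧ Q ⊆ B) V W

/-- A realization: for each coordinate a map `f i : S → Set (X i)` taking
nonempty proper values and sending complementary letters to complementary sets. -/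
def IsRealization (c : S → S) (X : Fin d → Type) (f : ∀ i, S → Set (X i)) : Prop :=
  ∀ i s, (f i s).Nonempty ∧ f i s ≠ Set.univ ∧ f i (c s) = (f i s)ᶜ

/-- The box associated to a word by a realization. -/
def box {X : Fin d → Type} (f : ∀ i, S → Set (X i)) (v : Fin d → S) :
    Set (∀ i, X i) :=
  {x | ∀ i, x i ∈ f i (v i)}

/-- The word `w` is covered by the code `V` (`w ⊑ V`). -/
def CoveredWord (c : S → S) (w : Fin d → S) (V : Finset (Fin d → S)) : Prop :=
  ∀ (X : Fin d → Type) (f : ∀ i, S → Set (X i)), IsRealization c X f →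
    box f w ⊆ ⋃ v ∈ V, box f v

/-- `V ⊑ W`: every word of `V` is covered by `W`. -/
def Covered (c : S → S) (V W : Finset (Fin d → S)) : Prop :=
  ∀ v ∈ V, CoveredWord c v W

/-- Equivalent codes: `V ⊑ W` and `W ⊑ V`. -/
def Equivalent (c : S → S) (V W : Finset (Fin d → S)) : Prop :=
  Covered c V W ∧ Covered c W V

/-- `V ⊑̇ W`: `V ⊑ W` and no word of `V` belongs to any code obtained from `W`
by gluing and cutting. -/
def DotCovered (c : S → S) (V W : Finset (Fin d → S)) : Prop :=
  Covered c V W ∧ ∀ v ∈ V, ∀ W', GC c W W' → v ∉ W'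

/-- The density `δ(V, W)`. -/
noncomputable def delta (c : S → S) (V W : Finset (Fin d → S)) : ℕ∞ :=
  W.inf fun w => ((V.filter fun v => ¬ Dich c v w).card : ℕ∞)

/-- `C` is a minimal cover of the word `w`. -/
def MinCoverWord (c : S → S) (C : Finset (Fin d → S)) (w : Fin d → S) : Prop :=
  IsCode c C ∧ CoveredWord c w C ∧ ∀ q ∈ C, ¬ Dich c q w

/-- `C` is a minimal cover of the code `P`. -/
def MinCoverCode (c : S → S) (C P : Finset (Fin d → S)) : Prop :=
  IsCode c C ∧ Covered c P C ∧ ∀ q ∈ C, ∃ p ∈ P, ¬ Dich c q p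

/-- A simple polybox code. -/
def SimpleCode (c : S → S) (V : Finset (Fin d → S)) : Prop :=
  ∀ i : Fin d, ∃ s : S, ∀ v ∈ V, v i = s ∨ v i = c s

/-- A simple cube tiling code `{s₁, s₁'} × ⋯ × {s_d, s_d'}`. -/
def SimpleCubeTiling (c : S → S) (U : Finset (Fin d → S)) : Prop :=
  ∃ s : Fin d → S, ∀ v : Fin d → S, v ∈ U ↔ ∀ i, v i = s i ∨ v i = c (s i)

/-- Word whose first four coordinates are `x0 x1 x2 x3` and which agrees with
`r` elsewhere. -/
def specialWord (r : Fin d → S) (x0 x1 x2 x3 : S) : Fin d → S := fun i =>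
  if (i : ℕ) = 0 then x0 else if (i : ℕ) = 1 then x1 else if (i : ℕ) = 2 then x2
  else if (i : ℕ) = 3 then x3 else r i

/-- The special pair of 12-word codes (Theorem 1 of the paper). -/
def SpecialPair (c : S → S) (V W : Finset (Fin d → S)) : Prop :=
  ∃ (a b : S) (r : Fin d → S), a ≠ b ∧ a ≠ c b ∧
    V = {specialWord r a (c a) b (c b), specialWord r a b (c b) a,
         specialWord r a (c b) (c b) (c b), specialWord r (c a) a (c b) (c b),
         specialWord r (c a) (c a) a (c b), specialWord r (c a) b (c b) b,
         specialWord r b a b (c b), specialWord r b b b b,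
         specialWord r b (c b) (c a) b, specialWord r (c b) a b (c a),
         specialWord r (c b) (c a) b b, specialWord r (c b) (c b) (c b) b} ∧
    W = {specialWord r (c a) (c a) (c a) b, specialWord r (c a) b a (c a),
         specialWord r b a (c a) a, specialWord r a (c a) (c a) a,
         specialWord r (c a) a (c a) (c a), specialWord r a b b (c a),
         specialWord r b b a a, specialWord r a (c b) (c a) (c a),
         specialWord r (c b) a (c b) a, specialWord r (c b) (c a) a a,
         specialWord r (c b) (c b) a (c a), specialWord r b (c b) a (c b)}

/-- An isomorphism of `S^d`: a permutation of coordinates followed by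
position bijections commuting with complementation. -/
def IsIso (c : S → S) (Φ : (Fin d → S) → Fin d → S) : Prop :=
  ∃ (σ : Equiv.Perm (Fin d)) (h : Fin d → S → S),
    (∀ i, Function.Bijective (h i)) ∧ (∀ i s, h i (c s) = c (h i s)) ∧
    ∀ v i, Φ v i = h i (v (σ i))

/-- The pair `(V, W)` is, up to isomorphism, the special pair. -/
def SpecialPairUpToIso (c : S → S) (V W : Finset (Fin d → S)) : Prop :=
  ∃ Φ, IsIso c Φ ∧
    (SpecialPair c (V.image Φ) (W.image Φ) ∨ SpecialPair c (W.image Φ) (V.image Φ))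


section helpers
set_option linter.unusedSectionVars false
set_option linter.unusedVariables false
set_option linter.unusedSimpArgs false
set_option linter.unnecessarySimpa false
variable {S : Type} [Fintype S] [DecidableEq S] {d : ℕ}

/-- complementation -/
class Cpl (c : S → S) : Prop where
  inv : ∀ s, c (c s) = s
  ne : ∀ s, c s ≠ s

variable {c : S → S} [hI : Cpl c]

theorem cc (s : S) : c (c s) = s := Cpl.inv s
theorem cne (s : S) : c s ≠ s := Cpl.ne s
theorem cinj {s t : S} (h : c s = c t) : s = t := by
  rw [← cc (c := c) s, h, cc (c := c)]
theorem ceq {s t : S} (h : s = c t) : t = c s := by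
  rw [h, cc (c := c)]

theorem dich_symm {v w : Fin d → S} (h : Dich c v w) : Dich c w v := by
  obtain ⟨i, hi⟩ := h
  exact ⟨i, ceq hi⟩

theorem not_dich_self (v : Fin d → S) : ¬ Dich c v v := by
  rintro ⟨i, hi⟩
  exact cne (c := c) _ hi.symm

/-- abstract points -/
abbrev Pt (c : S → S) := {f : S → Bool // ∀ s, f (c s) = !f s}

theorem exists_pt_of (P : S → Prop) (hP : ∀ s, P s → ¬ P (c s)) :
    ∃ f : Pt c, ∀ s, P s → f.1 s = true := by
  classical
  let e := Fintype.equivFin S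
  refine ⟨⟨fun s => if P s then true else if P (c s) then false else decide (e s < e (c s)), ?_⟩, ?_⟩
  · intro s
    have := hP s
    have h2 := hP (c s)
    rw [cc (c := c)] at h2
    by_cases h : P s
    · have := hP s h
      simp [h, this, cc]
    · by_cases h' : P (c s)
      · simp [h, h', cc]
      · have : e s ≠ e (c s) := fun h => cne (c := c) s (e.injective h).symm
        simp only [h, h', cc, if_false]
        rcases lt_or_gt_of_ne this with h1 | h1
        · simp [h1, h1.le]
        · simp [h1, h1.le]
  · intro s hs
    simp [hs]

theorem exists_pt2 {s t : S} (h : s ≠ c t) : ∃ f : Pt c, f.1 s = true ∧ f.1 t = true := by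
  obtain ⟨f, hf⟩ := exists_pt_of (c := c) (fun x => x = s ∨ x = t) (by
    have := cne (c := c) s
    have := cne (c := c) t
    have : c s ≠ t := fun h' => h (ceq h'.symm)
    rintro x (rfl | rfl) (h | h) <;> simp_all)
  exact ⟨f, hf s (Or.inl rfl), hf t (Or.inr rfl)⟩

theorem exists_pt3 {s t u : S} (h : s ≠ c t) (h1 : u ≠ s) (h2 : u ≠ t) :
    ∃ f : Pt c, f.1 s = true ∧ f.1 t = true ∧ f.1 u = false := by
  obtain ⟨f, hf⟩ := exists_pt_of (c := c) (fun x => x = s ∨ x = t ∨ x = c u) (by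
    have := cne (c := c) s
    have := cne (c := c) t
    have := cne (c := c) u
    have := cc (c := c) u
    have : c s ≠ t := fun h' => h (ceq h'.symm)
    have : c s ≠ c u := fun h => h1 (cinj h).symm
    have : c t ≠ c u := fun h => h2 (cinj h).symm
    rintro x (rfl | rfl | rfl) (h | h | h) <;> simp_all)
  refine ⟨f, hf s (Or.inl rfl), hf t (Or.inr (Or.inl rfl)), ?_⟩
  have := hf _ (Or.inr (Or.inr rfl))
  rw [f.2] at this
  simpa using this

/-- point in box -/
def InB (p : Fin d → Pt c) (v : Fin d → S) : Prop := ∀ i, (p i).1 (v i) = true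

instance (p : Fin d → Pt c) (v : Fin d → S) : Decidable (InB p v) := by
  unfold InB; infer_instance

/-- covered points -/
def Cov (p : Fin d → Pt c) (A : Finset (Fin d → S)) : Prop := ∃ v ∈ A, InB p v

/-- equivalence of codes -/
def Eqv (c : S → S) (A B : Finset (Fin d → S)) : Prop :=
  ∀ p : Fin d → Pt c, Cov p A ↔ Cov p B

theorem not_dich_of_InB {p : Fin d → Pt c} {v w : Fin d → S} (h1 : InB p v) (h2 : InB p w) :
    ¬ Dich c v w := by
  rintro ⟨i, hi⟩
  have h1 := h1 i
  rw [hi, (p i).2, h2 i] at h1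
  simp at h1

theorem exists_InB2 {v w : Fin d → S} (h : ¬ Dich c v w) :
    ∃ p : Fin d → Pt c, InB p v ∧ InB p w := by
  have : ∀ i, ∃ f : Pt c, f.1 (v i) = true ∧ f.1 (w i) = true := by
    intro i
    apply exists_pt2
    intro h'
    exact h ⟨i, h'⟩
  choose p hp using this
  exact ⟨p, fun i => (hp i).1, fun i => (hp i).2⟩

theorem exists_InB (v : Fin d → S) : ∃ p : Fin d → Pt c, InB p v := by
  obtain ⟨p, hp, _⟩ := exists_InB2 (not_dich_self (c := c) v)
  exact ⟨p, hp⟩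

theorem code_uniq {A : Finset (Fin d → S)} (hA : IsCode c A) {p : Fin d → Pt c}
    {v w : Fin d → S} (hv : v ∈ A) (hw : w ∈ A) (h1 : InB p v) (h2 : InB p w) : v = w := by
  by_contra h
  exact not_dich_of_InB h1 h2 (hA v hv w hw h)

/-- flip -/
def fl (f : Pt c) (s : S) : Pt c :=
  ⟨fun t => if t = s ∨ t = c s then !f.1 t else f.1 t, by
    intro t
    have : (c t = s ∨ c t = c s) ↔ (t = s ∨ t = c s) := by
      constructor
      · rintro (h | h)
        · exact Or.inr (ceq h.symm)
        · exact Or.inl (cinj h)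
      · rintro (h | h)
        · rw [h]; simp
        · rw [h, cc (c := c)]; simp
    simp only [this, f.2]
    split_ifs <;> rfl⟩

theorem fl_val (f : Pt c) (s t : S) :
    (fl f s).1 t = if t = s ∨ t = c s then !f.1 t else f.1 t := rfl

theorem fl_self (f : Pt c) (s : S) : (fl f s).1 s = !f.1 s := by simp [fl_val]

theorem fl_of_ne (f : Pt c) {s t : S} (h1 : t ≠ s) (h2 : t ≠ c s) : (fl f s).1 t = f.1 t := by
  simp [fl_val, h1, h2]

theorem fl_fl (f : Pt c) (s : S) : fl (fl f s) s = f := by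
  apply Subtype.ext
  funext t
  simp only [fl_val]
  split_ifs <;> simp

theorem fl_c (f : Pt c) (s : S) : fl f (c s) = fl f s := by
  apply Subtype.ext
  funext t
  simp only [fl_val, cc, or_comm]

/-- flip in a coordinate -/
def flp (p : Fin d → Pt c) (j : Fin d) (s : S) : Fin d → Pt c :=
  Function.update p j (fl (p j) s)

theorem flp_flp (p : Fin d → Pt c) (j : Fin d) (s : S) : flp (flp p j s) j s = p := by
  simp [flp, fl_fl]

theorem flp_c (p : Fin d → Pt c) (j : Fin d) (s : S) : flp p j (c s) = flp p j s := by
  simp [flp, fl_c]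

theorem InB_flp_of_ne {p : Fin d → Pt c} {j : Fin d} {s : S} {w : Fin d → S}
    (h1 : w j ≠ s) (h2 : w j ≠ c s) : InB (flp p j s) w ↔ InB p w := by
  unfold InB
  apply forall_congr'
  intro i
  by_cases h : i = j
  · subst h
    simp [flp, fl_of_ne _ h1 h2]
  · simp [flp, h]

theorem InB_flp_update {p : Fin d → Pt c} {j : Fin d} {s : S} {w : Fin d → S} (hw : w j = s) :
    InB (flp p j s) w ↔ InB p (Function.update w j (c s)) := by
  unfold InB
  apply forall_congr'
  intro i
  by_cases h : i = j
  · subst h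
    simp [flp, hw, fl_self, (p i).2]
  · simp [flp, h]

theorem not_InB_flp {p : Fin d → Pt c} {j : Fin d} {s : S} {w : Fin d → S} (hw : w j = s)
    (h : InB p w) : ¬ InB (flp p j s) w := by
  intro h'
  have h1 := h j
  have h2 := h' j
  simp only [flp, Function.update_self, hw, fl_self] at h1 h2
  simp [h1] at h2

theorem Eqv.refl (A : Finset (Fin d → S)) : Eqv c A A := fun _ => Iff.rfl
theorem Eqv.symm {A B : Finset (Fin d → S)} (h : Eqv c A B) : Eqv c B A := fun p => (h p).symm
theorem Eqv.trans {A B C : Finset (Fin d → S)} (h : Eqv c A B) (h' : Eqv c B C) : Eqv c A C :=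
  fun p => (h p).trans (h' p)

theorem Cov_union {p : Fin d → Pt c} {A B : Finset (Fin d → S)} :
    Cov p (A ∪ B) ↔ Cov p A ∨ Cov p B := by
  simp only [Cov, Finset.mem_union]
  constructor
  · rintro ⟨v, h | h, h'⟩
    · exact Or.inl ⟨v, h, h'⟩
    · exact Or.inr ⟨v, h, h'⟩
  · rintro (⟨v, h, h'⟩ | ⟨v, h, h'⟩)
    · exact ⟨v, Or.inl h, h'⟩
    · exact ⟨v, Or.inr h, h'⟩

theorem card_half (s : S) :
    2 * (Finset.univ.filter (fun f : Pt c => f.1 s = true)).card = Fintype.card (Pt c) := by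
  classical
  have h1 : (Finset.univ.filter (fun f : Pt c => f.1 s = true)).card
      = (Finset.univ.filter (fun f : Pt c => ¬ f.1 s = true)).card := by
    apply Finset.card_nbij' (fun f => fl f s) (fun f => fl f s)
    · intro f hf
      simp at hf ⊢
      simp [fl_self, hf]
    · intro f hf
      simp at hf ⊢
      simp [fl_self, hf]
    · intro f hf
      exact fl_fl f s
    · intro f hf
      exact fl_fl f s
  have h2 := Finset.card_filter_add_card_filter_not (s := (Finset.univ : Finset (Pt c)))
    (fun f : Pt c => f.1 s = true)
  rw [Finset.card_univ] at h2
  omega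

theorem card_quarter {s t : S} (h1 : t ≠ s) (h2 : t ≠ c s) :
    4 * (Finset.univ.filter (fun f : Pt c => f.1 s = true ∧ f.1 t = true)).card
      = Fintype.card (Pt c) := by
  classical
  have h3 : s ≠ t := h1.symm
  have h4 : s ≠ c t := fun h => h2 (ceq h)
  have e1 : (Finset.univ.filter (fun f : Pt c => f.1 s = true ∧ f.1 t = true)).card
      = (Finset.univ.filter (fun f : Pt c => f.1 s = true ∧ ¬ f.1 t = true)).card := by
    apply Finset.card_nbij' (fun f => fl f t) (fun f => fl f t)
    · intro f hf
      simp at hf ⊢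
      simp [fl_self, hf, fl_of_ne f h3 h4]
    · intro f hf
      simp at hf ⊢
      simp [fl_self, hf, fl_of_ne f h3 h4]
    · intro f hf
      exact fl_fl f t
    · intro f hf
      exact fl_fl f t
  have e2 := Finset.card_filter_add_card_filter_not
    (s := (Finset.univ.filter (fun f : Pt c => f.1 s = true)))
    (fun f : Pt c => f.1 t = true)
  rw [Finset.filter_filter, Finset.filter_filter] at e2
  have := card_half (c := c) s
  omega

/-- box as a finite set of points -/
def bx (c : S → S) (v : Fin d → S) : Finset (Fin d → Pt c) := Finset.univ.filter (fun p => InB p v)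

theorem mem_bx {v : Fin d → S} {p : Fin d → Pt c} : p ∈ bx c v ↔ InB p v := by
  simp [bx]

/-- number of agreements -/
def zz (v w : Fin d → S) : ℕ := (Finset.univ.filter (fun i => w i = v i)).card

theorem card_bx_inter {v w : Fin d → S} (h : ¬ Dich c w v) :
    (bx c v ∩ bx c w).card * 4 ^ d = Fintype.card (Pt c) ^ d * 2 ^ (zz v w) := by
  classical
  have e : bx c v ∩ bx c w = Fintype.piFinset
      (fun i => Finset.univ.filter (fun f : Pt c => f.1 (v i) = true ∧ f.1 (w i) = true)) := by
    ext p
    simp [mem_bx, InB, forall_and]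
  rw [e, Fintype.card_piFinset]
  have : (∏ i : Fin d, (Finset.univ.filter
      (fun f : Pt c => f.1 (v i) = true ∧ f.1 (w i) = true)).card) * (∏ i : Fin d, 4) =
      (∏ i : Fin d, Fintype.card (Pt c)) * (∏ i : Fin d, if w i = v i then 2 else 1) := by
    rw [← Finset.prod_mul_distrib, ← Finset.prod_mul_distrib]
    apply Finset.prod_congr rfl
    intro i _
    by_cases hi : w i = v i
    · have := card_half (c := c) (v i)
      rw [hi]
      simp only [and_self, if_true]
      omega
    · have := card_quarter (c := c) hi (fun h' => h ⟨i, h'⟩)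
      simp only [hi, if_false]
      omega
  rw [Finset.prod_const, Finset.prod_const, Finset.card_univ, Fintype.card_fin] at this
  rw [this, Finset.prod_ite]
  simp [zz]

theorem card_Pt_pos : 0 < Fintype.card (Pt c) := by
  obtain ⟨f, _⟩ := exists_pt_of (c := c) (fun _ => False) (by simp)
  exact Fintype.card_pos_iff.mpr ⟨f⟩

theorem card_bx (v : Fin d → S) :
    (bx c v).card * 4 ^ d = Fintype.card (Pt c) ^ d * 2 ^ d := by
  have := card_bx_inter (not_dich_self (c := c) v)
  rw [Finset.inter_self] at this
  rw [this]
  simp [zz]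

/-- covered point set -/
def cs (c : S → S) (A : Finset (Fin d → S)) : Finset (Fin d → Pt c) := A.biUnion (bx c)

theorem mem_cs {A : Finset (Fin d → S)} {p : Fin d → Pt c} : p ∈ cs c A ↔ Cov p A := by
  simp [cs, mem_bx, Cov]

theorem bx_disj {A : Finset (Fin d → S)} (hA : IsCode c A) :
    (A : Set (Fin d → S)).PairwiseDisjoint (bx c) := by
  intro v hv w hw hvw
  rw [Function.onFun, Finset.disjoint_left]
  intro p h1 h2
  exact hvw (code_uniq hA hv hw (mem_bx.1 h1) (mem_bx.1 h2))

theorem card_cs {A : Finset (Fin d → S)} (hA : IsCode c A) :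
    (cs c A).card * 4 ^ d = A.card * (Fintype.card (Pt c) ^ d * 2 ^ d) := by
  rw [cs, Finset.card_biUnion (bx_disj hA), Finset.sum_mul, Finset.sum_congr rfl
    (fun v _ => card_bx (c := c) v)]
  simp

theorem card_le_of_sub {A B : Finset (Fin d → S)} (hA : IsCode c A) (hB : IsCode c B)
    (h : ∀ p : Fin d → Pt c, Cov p A → Cov p B) : A.card ≤ B.card := by
  have h1 := card_cs hA
  have h2 := card_cs hB
  have h3 : (cs c A).card ≤ (cs c B).card := Finset.card_le_card (by
    intro p hp
    exact mem_cs.2 (h p (mem_cs.1 hp)))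
  have : 0 < Fintype.card (Pt c) ^ d * 2 ^ d := by
    have := card_Pt_pos (c := c)
    positivity
  by_contra hlt
  push Not at hlt
  have := Nat.mul_lt_mul_of_pos_right hlt this
  have := Nat.mul_le_mul_right (4 ^ d) h3
  omega

theorem card_eq_of_Eqv {A B : Finset (Fin d → S)} (hA : IsCode c A) (hB : IsCode c B)
    (h : Eqv c A B) : A.card = B.card :=
  le_antisymm (card_le_of_sub hA hB fun p => (h p).1) (card_le_of_sub hB hA fun p => (h p).2)

theorem Eqv_of_card {A B : Finset (Fin d → S)} (hA : IsCode c A) (hB : IsCode c B)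
    (h : ∀ p : Fin d → Pt c, Cov p A → Cov p B) (hc : A.card = B.card) : Eqv c A B := by
  have h1 := card_cs hA
  have h2 := card_cs hB
  have h3 : cs c A ⊆ cs c B := by
    intro p hp
    exact mem_cs.2 (h p (mem_cs.1 hp))
  have h4 : cs c A = cs c B := by
    apply Finset.eq_of_subset_of_card_le h3
    rw [hc, ← h2] at h1
    exact (Nat.eq_of_mul_eq_mul_right (by positivity) h1).ge
  intro p
  rw [← mem_cs, ← mem_cs, h4]

/-- simple code on positions J -/
def UJ (c : S → S) (r : Fin d → S) (J : Finset (Fin d)) : Finset (Fin d → S) :=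
  Fintype.piFinset (fun i => if i ∈ J then {r i, c (r i)} else {r i})

/-- constant outside J -/
def CO (r : Fin d → S) (J : Finset (Fin d)) (A : Finset (Fin d → S)) : Prop :=
  ∀ w ∈ A, ∀ i, i ∉ J → w i = r i

theorem mem_UJ {r : Fin d → S} {J : Finset (Fin d)} {w : Fin d → S} :
    w ∈ UJ c r J ↔ ∀ i, (i ∈ J → w i = r i ∨ w i = c (r i)) ∧ (i ∉ J → w i = r i) := by
  simp only [UJ, Fintype.mem_piFinset]
  apply forall_congr'
  intro i
  by_cases h : i ∈ J <;> simp [h]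

theorem card_UJ (r : Fin d → S) (J : Finset (Fin d)) : (UJ c r J).card = 2 ^ J.card := by
  rw [UJ, Fintype.card_piFinset]
  have : ∀ i ∈ Finset.univ, (if i ∈ J then ({r i, c (r i)} : Finset S) else {r i}).card =
      if i ∈ J then 2 else 1 := by
    intro i _
    by_cases h : i ∈ J
    · simp only [h, if_true]
      rw [Finset.card_pair (cne (c := c) _).symm]
    · simp [h]
  rw [Finset.prod_congr rfl this, Finset.prod_ite]
  simp

theorem code_UJ (r : Fin d → S) (J : Finset (Fin d)) : IsCode c (UJ c r J) := by
  intro v hv w hw hvw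
  rw [mem_UJ] at hv hw
  obtain ⟨i, hi⟩ := Function.ne_iff.1 hvw
  refine ⟨i, ?_⟩
  by_cases h : i ∈ J
  · rcases (hv i).1 h with h1 | h1 <;> rcases (hw i).1 h with h2 | h2
    · exact absurd (h1.trans h2.symm) hi
    · rw [h1, h2, cc (c := c)]
    · rw [h1, h2]
    · exact absurd (h1.trans h2.symm) hi
  · exact absurd (((hv i).2 h).trans ((hw i).2 h).symm) hi

theorem CO_UJ (r : Fin d → S) (J : Finset (Fin d)) : CO r J (UJ c r J) := by
  intro w hw i hi
  exact ((mem_UJ.1 hw) i).2 hi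

theorem Cov_UJ {r : Fin d → S} {J : Finset (Fin d)} {A : Finset (Fin d → S)} (hA : CO r J A)
    (p : Fin d → Pt c) (h : Cov p A) : Cov p (UJ c r J) := by
  obtain ⟨v, hv, hp⟩ := h
  refine ⟨fun i => if i ∈ J then (if (p i).1 (r i) = true then r i else c (r i)) else r i, ?_, ?_⟩
  · rw [mem_UJ]
    intro i
    by_cases h : i ∈ J
    · by_cases h' : (p i).1 (r i) = true <;> simp [h, h']
    · simp [h]
  · intro i
    by_cases h : i ∈ J
    · by_cases h' : (p i).1 (r i) = true <;> simp [h, h', (p i).2]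
    · have := hp i
      rw [hA v hv i h] at this
      simp [h, this]

theorem card_le_of_CO {r : Fin d → S} {J : Finset (Fin d)} {A : Finset (Fin d → S)}
    (hA : IsCode c A) (hr : CO r J A) : A.card ≤ 2 ^ J.card := by
  rw [← card_UJ (c := c) r J]
  exact card_le_of_sub hA (code_UJ r J) (Cov_UJ hr)

theorem Eqv_UJ {r : Fin d → S} {J : Finset (Fin d)} {A : Finset (Fin d → S)}
    (hA : IsCode c A) (hr : CO r J A) (h : A.card = 2 ^ J.card) : Eqv c A (UJ c r J) :=
  Eqv_of_card hA (code_UJ r J) (Cov_UJ hr) (by rw [h, card_UJ])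

/-- letters off J are fixed along equivalence -/
theorem CO_of_Eqv {r : Fin d → S} {J : Finset (Fin d)} {A B : Finset (Fin d → S)}
    (hr : CO r J A) (h : Eqv c A B) : CO r J B := by
  intro w hw i hi
  by_contra hne
  have : ∀ k, ∃ f : Pt c, f.1 (w k) = true ∧ (k = i → f.1 (r i) = false) := by
    intro k
    by_cases hk : k = i
    · subst hk
      obtain ⟨f, h1, _, h2⟩ := exists_pt3 (c := c) (s := w k) (t := w k) (u := r k)
        (cne (c := c) _).symm (Ne.symm hne) (Ne.symm hne)
      exact ⟨f, h1, fun _ => h2⟩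
    · obtain ⟨f, h1, _⟩ := exists_pt2 (c := c) (s := w k) (t := w k) (cne (c := c) _).symm
      exact ⟨f, h1, fun h => absurd h hk⟩
  choose p hp using this
  obtain ⟨v, hv, hpv⟩ := (h p).2 ⟨w, hw, fun k => (hp k).1⟩
  have h1 := hpv i
  rw [hr v hv i hi, (hp i).2 rfl] at h1
  simp at h1

theorem IsCode.mono {A B : Finset (Fin d → S)} (hB : IsCode c B) (h : A ⊆ B) : IsCode c A :=
  fun v hv w hw hne => hB v (h hv) w (h hw) hne

theorem twin_InB {v w : Fin d → S} {i : Fin d} (h : TwinPair c v w i) (p : Fin d → Pt c) :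
    (InB p v ∨ InB p w) ↔ ∀ k, k ≠ i → (p k).1 (v k) = true := by
  constructor
  · rintro (h1 | h1) k hk
    · exact h1 k
    · rw [h.2 k hk]; exact h1 k
  · intro h1
    by_cases hi : (p i).1 (v i) = true
    · left
      intro k
      by_cases hk : k = i
      · rw [hk]; exact hi
      · exact h1 k hk
    · right
      intro k
      by_cases hk : k = i
      · rw [hk]
        rw [h.1, (p i).2] at hi
        simpa using hi
      · rw [← h.2 k hk]; exact h1 k hk

theorem Cov_pair {p : Fin d → Pt c} {v w : Fin d → S} :
    Cov p {v, w} ↔ InB p v ∨ InB p w := by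
  simp [Cov]

theorem twin_Eqv {v w q t : Fin d → S} {i : Fin d} (h : TwinPair c v w i)
    (h' : TwinPair c q t i) (hq : ∀ j, j ≠ i → q j = v j) : Eqv c {v, w} {q, t} := by
  intro p
  rw [Cov_pair, Cov_pair, twin_InB h, twin_InB h']
  apply forall_congr'
  intro k
  apply imp_congr_right
  intro hk
  rw [hq k hk]

theorem twin_code {v w : Fin d → S} {i : Fin d} (h : TwinPair c v w i) : IsCode c {v, w} := by
  intro x hx y hy hne
  simp only [Finset.mem_insert, Finset.mem_singleton] at hx hy
  rcases hx with rfl | rfl <;> rcases hy with rfl | rfl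
  · exact absurd rfl hne
  · exact ⟨i, h.1⟩
  · exact dich_symm ⟨i, h.1⟩
  · exact absurd rfl hne

theorem code_swap {X Y Z : Finset (Fin d → S)} (hXZ : IsCode c (X ∪ Z)) (hd : Disjoint X Z)
    (hY : IsCode c Y) (h : Eqv c X Y) : IsCode c (Y ∪ Z) ∧ Disjoint Y Z := by
  have key : ∀ y ∈ Y, ∀ z ∈ Z, Dich c y z := by
    intro y hy z hz
    by_contra hn
    obtain ⟨p, h1, h2⟩ := exists_InB2 hn
    obtain ⟨x, hx, hpx⟩ := (h p).2 ⟨y, hy, h1⟩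
    have := code_uniq hXZ (Finset.mem_union_left _ hx) (Finset.mem_union_right _ hz) hpx h2
    subst this
    exact (Finset.disjoint_left.1 hd) hx hz
  constructor
  · intro v hv w hw hne
    rcases Finset.mem_union.1 hv with hv | hv <;> rcases Finset.mem_union.1 hw with hw | hw
    · exact hY v hv w hw hne
    · exact key v hv w hw
    · exact dich_symm (key w hw v hv)
    · exact hXZ v (Finset.mem_union_right _ hv) w (Finset.mem_union_right _ hw) hne
  · rw [Finset.disjoint_left]
    intro v h1 h2
    exact not_dich_self v (key v h1 v h2)

theorem Eqv_union {X Y Z : Finset (Fin d → S)} (h : Eqv c X Y) : Eqv c (X ∪ Z) (Y ∪ Z) := by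
  intro p
  rw [Cov_union, Cov_union, h p]

theorem step_facts {V W : Finset (Fin d → S)} (hV : IsCode c V) (h : GCStep c V W) :
    IsCode c W ∧ Eqv c V W ∧ GCStep c W V := by
  obtain ⟨v, w, q, t, i, hv, hw, h1, h2, h3, rfl⟩ := h
  have hsub : ({v, w} : Finset (Fin d → S)) ⊆ V := by
    intro x hx
    simp only [Finset.mem_insert, Finset.mem_singleton] at hx
    rcases hx with rfl | rfl <;> assumption
  have hVe : V = {v, w} ∪ (V \ {v, w}) := (Finset.union_sdiff_of_subset hsub).symm
  have hd : Disjoint ({v, w} : Finset (Fin d → S)) (V \ {v, w}) := Finset.disjoint_sdiff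
  have hE := twin_Eqv h1 h2 h3
  obtain ⟨k1, k2⟩ := code_swap (X := {v, w}) (Z := V \ {v, w}) (by rw [← hVe]; exact hV) hd
    (twin_code h2) hE
  refine ⟨by rw [Finset.union_comm]; exact k1, ?_, ?_⟩
  · have := Eqv_union (Z := V \ {v, w}) hE
    rw [← hVe] at this
    rw [Finset.union_comm]
    exact this
  · refine ⟨q, t, v, w, i, by simp, by simp, h2, h1, fun j hj => (h3 j hj).symm, ?_⟩
    rw [Finset.union_sdiff_distrib, Finset.sdiff_self, Finset.union_empty,
      Finset.sdiff_eq_self_of_disjoint k2.symm, Finset.union_comm]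
    exact hVe

theorem GC.refl (V : Finset (Fin d → S)) : GC c V V := Relation.ReflTransGen.refl
theorem GC.trans {A B C : Finset (Fin d → S)} (h : GC c A B) (h' : GC c B C) : GC c A C :=
  Relation.ReflTransGen.trans h h'
theorem GC.single {A B : Finset (Fin d → S)} (h : GCStep c A B) : GC c A B :=
  Relation.ReflTransGen.single h

theorem GC_facts {V W : Finset (Fin d → S)} (hV : IsCode c V) (h : GC c V W) :
    IsCode c W ∧ Eqv c V W ∧ GC c W V := by
  unfold GC at h
  induction h with
  | refl => exact ⟨hV, Eqv.refl _, GC.refl _⟩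
  | tail _ hs ih =>
    obtain ⟨h1, h2, h3⟩ := ih
    obtain ⟨k1, k2, k3⟩ := step_facts h1 hs
    exact ⟨k1, h2.trans k2, (GC.single k3).trans h3⟩

theorem GC.code {V W : Finset (Fin d → S)} (h : GC c V W) (hV : IsCode c V) : IsCode c W :=
  (GC_facts hV h).1
theorem GC.eqv {V W : Finset (Fin d → S)} (h : GC c V W) (hV : IsCode c V) : Eqv c V W :=
  (GC_facts hV h).2.1
theorem GC.symm {V W : Finset (Fin d → S)} (h : GC c V W) (hV : IsCode c V) : GC c W V :=
  (GC_facts hV h).2.2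

theorem GCFix.gc {Q V W : Finset (Fin d → S)} (h : GCFix c Q V W) : GC c V W := by
  unfold GCFix at h
  induction h with
  | refl => exact GC.refl _
  | tail _ h ih => exact Relation.ReflTransGen.tail ih h.1
theorem GCFix.mono {Q Q' V W : Finset (Fin d → S)} (h : GCFix c Q V W) (hQ : Q' ⊆ Q) :
    GCFix c Q' V W := by
  unfold GCFix at h
  induction h with
  | refl => exact Relation.ReflTransGen.refl
  | tail _ h ih => exact Relation.ReflTransGen.tail ih ⟨h.1, hQ.trans h.2⟩
theorem GCFix.trans {Q A B C : Finset (Fin d → S)} (h : GCFix c Q A B) (h' : GCFix c Q B C) :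
    GCFix c Q A C := Relation.ReflTransGen.trans h h'
theorem GCFix.sub {Q A B : Finset (Fin d → S)} (h : GCFix c Q A B) (h' : Q ⊆ A) : Q ⊆ B := by
  unfold GCFix at h
  induction h with
  | refl => exact h'
  | tail _ h _ => exact h.2

theorem twin_update (v : Fin d → S) (i : Fin d) (a : S) :
    TwinPair c (Function.update v i a) (Function.update v i (c a)) i := by
  constructor
  · simp [cc (c := c)]
  · intro j hj
    simp [hj]

/-- change of a twin -/
theorem step_mk {V : Finset (Fin d → S)} {v : Fin d → S} {i : Fin d} (hv : v ∈ V)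
    (hw : Function.update v i (c (v i)) ∈ V) (a : S) :
    GCStep c V ((V \ {v, Function.update v i (c (v i))}) ∪
      {Function.update v i a, Function.update v i (c a)}) := by
  refine ⟨v, _, _, _, i, hv, hw, ?_, twin_update v i a, ?_, rfl⟩
  · have := twin_update (c := c) v i (v i)
    rwa [Function.update_eq_self] at this
  · intro j hj
    simp [hj]

theorem lift_GC {X Y Z : Finset (Fin d → S)} (h : GC c X Y) (hXZ : IsCode c (X ∪ Z))
    (hd : Disjoint X Z) : GCFix c Z (X ∪ Z) (Y ∪ Z) := by
  have hX : IsCode c X := hXZ.mono Finset.subset_union_left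
  unfold GC at h
  induction h with
  | refl => exact Relation.ReflTransGen.refl
  | @tail Y W hXY hs ih =>
    refine Relation.ReflTransGen.tail ih ⟨?_, Finset.subset_union_right⟩
    obtain ⟨k1, k2, k3⟩ := GC_facts hX hXY
    have hd' := (code_swap hXZ hd k1 k2).2
    obtain ⟨v, w, q, t, i, hv, hw, h1, h2, h3, rfl⟩ := hs
    refine ⟨v, w, q, t, i, Finset.mem_union_left _ hv, Finset.mem_union_left _ hw, h1, h2, h3, ?_⟩
    have hv' : v ∉ Z := Finset.disjoint_left.1 hd' hv
    have hw' : w ∉ Z := Finset.disjoint_left.1 hd' hw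
    ext x
    simp only [Finset.mem_union, Finset.mem_sdiff, Finset.mem_insert, Finset.mem_singleton]
    constructor
    · rintro ((h | h) | h)
      · exact Or.inl ⟨Or.inl h.1, h.2⟩
      · exact Or.inr h
      · refine Or.inl ⟨Or.inr h, ?_⟩
        rintro (rfl | rfl) <;> contradiction
    · rintro (⟨h | h, h'⟩ | h)
      · exact Or.inl (Or.inl ⟨h, h'⟩)
      · exact Or.inr h
      · exact Or.inl (Or.inr h)

theorem nonempty_of_Eqv {A B : Finset (Fin d → S)} (h : Eqv c A B) (hA : A.Nonempty) :
    B.Nonempty := by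
  obtain ⟨a, ha⟩ := hA
  obtain ⟨p, hp⟩ := exists_InB (c := c) a
  obtain ⟨b, hb, _⟩ := (h p).1 ⟨a, ha, hp⟩
  exact ⟨b, hb⟩

/-- remove a common part -/
theorem Eqv_of_union {X Y Z : Finset (Fin d → S)} (hX : IsCode c (X ∪ Z)) (hY : IsCode c (Y ∪ Z))
    (hd : Disjoint X Z) (hd' : Disjoint Y Z) (h : Eqv c (X ∪ Z) (Y ∪ Z)) : Eqv c X Y := by
  have : ∀ (X Y : Finset (Fin d → S)), IsCode c (X ∪ Z) → Disjoint X Z →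
      Eqv c (X ∪ Z) (Y ∪ Z) → ∀ p : Fin d → Pt c, Cov p X → Cov p Y := by
    intro X Y hX hd h p hp
    have h1 := (h p).1 (Cov_union.2 (Or.inl hp))
    rcases Cov_union.1 h1 with h1 | ⟨z, hz, hpz⟩
    · exact h1
    · obtain ⟨x, hx, hpx⟩ := hp
      have := code_uniq hX (Finset.mem_union_left _ hx) (Finset.mem_union_right _ hz) hpx hpz
      subst this
      exact absurd hz (Finset.disjoint_left.1 hd hx)
  exact fun p => ⟨this X Y hX hd h p, this Y X hY hd' h.symm p⟩

/-- slice -/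
def sl (A : Finset (Fin d → S)) (j : Fin d) (σ : S) : Finset (Fin d → S) :=
  A.filter (fun w => w j = σ)

/-- shift -/
def sh (A : Finset (Fin d → S)) (j : Fin d) (σ : S) : Finset (Fin d → S) :=
  A.image (fun w => Function.update w j σ)

theorem mem_sl {A : Finset (Fin d → S)} {j : Fin d} {σ : S} {w : Fin d → S} :
    w ∈ sl A j σ ↔ w ∈ A ∧ w j = σ := by simp [sl]

theorem sl_sub (A : Finset (Fin d → S)) (j : Fin d) (σ : S) : sl A j σ ⊆ A :=
  Finset.filter_subset _ _

theorem Cov_sh {B : Finset (Fin d → S)} {j : Fin d} {σ : S} {p : Fin d → Pt c} :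
    Cov p (sh (sl B j (c σ)) j σ) ↔ Cov (flp p j σ) (sl B j (c σ)) := by
  have key : ∀ w ∈ sl B j (c σ), (InB (flp p j σ) w ↔ InB p (Function.update w j σ)) := by
    intro w hw
    have := InB_flp_update (c := c) (p := p) (mem_sl.1 hw).2
    rw [flp_c, cc (c := c)] at this
    exact this
  simp only [Cov, sh, Finset.mem_image]
  constructor
  · rintro ⟨_, ⟨w, hw, rfl⟩, h⟩
    exact ⟨w, hw, (key w hw).2 h⟩
  · rintro ⟨w, hw, h⟩
    exact ⟨_, ⟨w, hw, rfl⟩, (key w hw).1 h⟩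

theorem sh_code {A : Finset (Fin d → S)} (hA : IsCode c A) (j : Fin d) (a σ : S) :
    IsCode c (sh (sl A j a) j σ) := by
  intro v hv w hw hne
  simp only [sh, Finset.mem_image] at hv hw
  obtain ⟨x, hx, rfl⟩ := hv
  obtain ⟨y, hy, rfl⟩ := hw
  rw [mem_sl] at hx hy
  have hxy : x ≠ y := fun h => hne (by rw [h])
  obtain ⟨i, hi⟩ := hA x hx.1 y hy.1 hxy
  have hij : i ≠ j := by
    rintro rfl
    rw [hx.2, hy.2] at hi
    exact cne (c := c) _ hi.symm
  exact ⟨i, by simpa [hij] using hi⟩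

theorem sh_inj (A : Finset (Fin d → S)) (j : Fin d) (a σ : S) :
    Set.InjOn (fun w => Function.update w j σ) (sl A j a : Set (Fin d → S)) := by
  intro x hx y hy h
  have hx := (mem_sl.1 hx).2
  have hy := (mem_sl.1 hy).2
  funext i
  by_cases hi : i = j
  · rw [hi, hx, hy]
  · have := congrFun h i
    simpa [hi] using this

theorem card_sh (A : Finset (Fin d → S)) (j : Fin d) (a σ : S) :
    (sh (sl A j a) j σ).card = (sl A j a).card :=
  Finset.card_image_of_injOn (sh_inj A j a σ)

theorem flp_j {p : Fin d → Pt c} {j : Fin d} {σ : S} :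
    (flp p j σ j).1 σ = !(p j).1 σ := by simp [flp, fl_self]

theorem InB_j {p : Fin d → Pt c} {w : Fin d → S} {j : Fin d} {σ : S} (h : InB p w) (hw : w j = σ) :
    (p j).1 σ = true := by rw [← hw]; exact h j

theorem InB_jc {p : Fin d → Pt c} {w : Fin d → S} {j : Fin d} {σ : S} (h : InB p w)
    (hw : w j = c σ) : (p j).1 σ = false := by
  have := h j
  rw [hw, (p j).2] at this
  simpa using this

theorem slice_lemma {A B : Finset (Fin d → S)} (hA : IsCode c A) (hB : IsCode c B)
    (hE : Eqv c A B) {j : Fin d} {σ : S} (hno : ∀ u ∈ A, u j ≠ c σ) :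
    Eqv c (sl B j σ) (sl A j σ ∪ sh (sl B j (c σ)) j σ) ∧
    IsCode c (sl A j σ ∪ sh (sl B j (c σ)) j σ) := by
  constructor
  · intro p
    rw [Cov_union, Cov_sh]
    constructor
    · rintro ⟨w, hw, hp⟩
      rw [mem_sl] at hw
      have hpj := InB_j hp hw.2
      obtain ⟨u, hu, hpu⟩ := (hE p).2 ⟨w, hw.1, hp⟩
      by_cases huj : u j = σ
      · exact Or.inl ⟨u, mem_sl.2 ⟨hu, huj⟩, hpu⟩
      · right
        obtain ⟨w', hw', hpw'⟩ := (hE (flp p j σ)).1 ⟨u, hu, (InB_flp_of_ne huj (hno u hu)).2 hpu⟩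
        by_cases h1 : w' j = σ
        · have := InB_j hpw' h1
          rw [flp_j, hpj] at this
          simp at this
        · by_cases h2 : w' j = c σ
          · exact ⟨w', mem_sl.2 ⟨hw', h2⟩, hpw'⟩
          · have := code_uniq hB hw' hw.1 ((InB_flp_of_ne h1 h2).1 hpw') hp
            exact absurd (this ▸ hw.2) h1
    · rintro (⟨u, hu, hp⟩ | ⟨w', hw', hp⟩)
      · rw [mem_sl] at hu
        have hpj := InB_j hp hu.2
        obtain ⟨w, hw, hpw⟩ := (hE p).1 ⟨u, hu.1, hp⟩
        by_cases h1 : w j = σ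
        · exact ⟨w, mem_sl.2 ⟨hw, h1⟩, hpw⟩
        · by_cases h2 : w j = c σ
          · have := InB_jc hpw h2
            simp [hpj] at this
          · obtain ⟨u', hu', hpu'⟩ := (hE (flp p j σ)).2 ⟨w, hw, (InB_flp_of_ne h1 h2).2 hpw⟩
            by_cases h3 : u' j = σ
            · have := InB_j hpu' h3
              rw [flp_j, hpj] at this
              simp at this
            · have := code_uniq hA hu' hu.1 ((InB_flp_of_ne h3 (hno u' hu')).1 hpu') hp
              exact absurd (this ▸ hu.2) h3
      · rw [mem_sl] at hw'
        have hpj := InB_jc hp hw'.2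
        rw [flp_j] at hpj
        have hpj : (p j).1 σ = true := by simpa using hpj
        obtain ⟨u, hu, hpu⟩ := (hE (flp p j σ)).2 ⟨w', hw'.1, hp⟩
        by_cases h3 : u j = σ
        · have := InB_j hpu h3
          rw [flp_j, hpj] at this
          simp at this
        · obtain ⟨w, hw, hpw⟩ := (hE p).1 ⟨u, hu, (InB_flp_of_ne h3 (hno u hu)).1 hpu⟩
          by_cases h1 : w j = σ
          · exact ⟨w, mem_sl.2 ⟨hw, h1⟩, hpw⟩
          · by_cases h2 : w j = c σ
            · have := InB_jc hpw h2
              simp [hpj] at this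
            · have := code_uniq hB hw hw'.1 ((InB_flp_of_ne h1 h2).2 hpw) hp
              exact absurd (this ▸ hw'.2) h2
  · have key : ∀ u ∈ sl A j σ, ∀ y ∈ sh (sl B j (c σ)) j σ, Dich c u y := by
      intro u hu y hy
      by_contra hn
      obtain ⟨p, h1, h2⟩ := exists_InB2 hn
      rw [mem_sl] at hu
      have hpj := InB_j h1 hu.2
      obtain ⟨w', hw', hp⟩ := Cov_sh.1 ⟨y, hy, h2⟩
      rw [mem_sl] at hw'
      obtain ⟨u', hu', hpu'⟩ := (hE (flp p j σ)).2 ⟨w', hw'.1, hp⟩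
      by_cases h3 : u' j = σ
      · have := InB_j hpu' h3
        rw [flp_j, hpj] at this
        simp at this
      · have := code_uniq hA hu' hu.1 ((InB_flp_of_ne h3 (hno u' hu')).1 hpu') h1
        exact absurd (this ▸ hu.2) h3
    intro v hv w hw hne
    rcases Finset.mem_union.1 hv with hv | hv <;> rcases Finset.mem_union.1 hw with hw | hw
    · exact hA v (sl_sub _ _ _ hv) w (sl_sub _ _ _ hw) hne
    · exact key v hv w hw
    · exact dich_symm (key w hw v hv)
    · exact sh_code hB _ _ _ v hv w hw hne

/-- weight of a word -/
def wt (φ : Fin d → S → ℕ) (w : Fin d → S) : ℕ := ∑ i, φ i (w i)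

/-- weight of a code -/
def Psi (φ : Fin d → S → ℕ) (V : Finset (Fin d → S)) : ℕ := ∑ w ∈ V, wt φ w

theorem wt_update (φ : Fin d → S → ℕ) (v : Fin d → S) (j : Fin d) (a : S) :
    wt φ (Function.update v j a) + φ j (v j) = wt φ v + φ j a := by
  unfold wt
  rw [← Finset.add_sum_erase _ _ (Finset.mem_univ j),
    ← Finset.add_sum_erase _ (fun i => φ i (v i)) (Finset.mem_univ j)]
  rw [Finset.sum_congr (g := fun i => φ i (v i)) rfl (by
    intro i hi
    rw [Function.update_of_ne (Finset.ne_of_mem_erase hi)])]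
  simp only [Function.update_self]
  omega

theorem Psi_union_le (φ : Fin d → S → ℕ) (A B : Finset (Fin d → S)) :
    Psi φ (A ∪ B) ≤ Psi φ A + Psi φ B := by
  unfold Psi
  rw [← Finset.sum_union_inter]
  omega

/-- weight after changing a twin -/
theorem F00 {V : Finset (Fin d → S)} {φ : Fin d → S → ℕ} (hφ : ∀ i s, φ i (c s) = φ i s)
    {v : Fin d → S} {j : Fin d} {τ : S} (hv : v ∈ V) (hw : Function.update v j (c (v j)) ∈ V) :
    Psi φ ((V \ {v, Function.update v j (c (v j))}) ∪
      {Function.update v j τ, Function.update v j (c τ)}) + 2 * φ j (v j) ≤ Psi φ V + 2 * φ j τ := by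
  have hne : v ≠ Function.update v j (c (v j)) := by
    intro h
    have := congrFun h j
    rw [Function.update_self] at this
    exact cne (c := c) _ this.symm
  have hsub : ({v, Function.update v j (c (v j))} : Finset (Fin d → S)) ⊆ V := by
    intro x hx
    simp only [Finset.mem_insert, Finset.mem_singleton] at hx
    rcases hx with rfl | rfl <;> assumption
  have e1 : Psi φ V = Psi φ (V \ {v, Function.update v j (c (v j))}) +
      (wt φ v + wt φ (Function.update v j (c (v j)))) := by
    unfold Psi
    rw [← Finset.sum_sdiff hsub, Finset.sum_pair hne]
  have hne2 : Function.update v j τ ≠ Function.update v j (c τ) := by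
    intro h
    have := congrFun h j
    rw [Function.update_self, Function.update_self] at this
    exact cne (c := c) _ this.symm
  have e2 : Psi φ {Function.update v j τ, Function.update v j (c τ)} =
      wt φ (Function.update v j τ) + wt φ (Function.update v j (c τ)) := by
    unfold Psi
    rw [Finset.sum_pair hne2]
  have e3 := Psi_union_le φ (V \ {v, Function.update v j (c (v j))})
    {Function.update v j τ, Function.update v j (c τ)}
  have f1 := wt_update φ v j τ
  have f2 := wt_update φ v j (c τ)
  have f3 := wt_update φ v j (c (v j))
  rw [hφ] at f2 f3
  omega

/-- changing a twin lowers the weight -/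
theorem F0 {V : Finset (Fin d → S)} {φ : Fin d → S → ℕ} (hφ : ∀ i s, φ i (c s) = φ i s)
    {v : Fin d → S} {j : Fin d} {τ : S} (hv : v ∈ V) (hw : Function.update v j (c (v j)) ∈ V)
    (h1 : 0 < φ j (v j)) (h2 : φ j τ = 0) :
    Psi φ ((V \ {v, Function.update v j (c (v j))}) ∪
      {Function.update v j τ, Function.update v j (c τ)}) < Psi φ V := by
  have := F00 hφ hv hw (τ := τ)
  omega

/-- flip lemma -/
theorem F1 {V : Finset (Fin d → S)} (hV : IsCode c V) {φ : Fin d → S → ℕ}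
    (hφ : ∀ i s, φ i (c s) = φ i s) {j : Fin d} {σ τ : S}
    (hGC : GC c (sl V j σ) (sh (sl V j (c σ)) j σ)) (hne : (sl V j σ).Nonempty)
    (h1 : 0 < φ j σ) (h2 : φ j τ = 0) (hle : Psi φ (sl V j (c σ)) ≤ Psi φ (sl V j σ)) :
    ∃ V', GCFix c (V.filter (fun w => w j ≠ σ ∧ w j ≠ c σ)) V V' ∧ Psi φ V' < Psi φ V := by
  have hXc : IsCode c (sl V j σ) := hV.mono (sl_sub _ _ _)
  have hVe : V = sl V j σ ∪ (V \ sl V j σ) := (Finset.union_sdiff_of_subset (sl_sub _ _ _)).symm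
  have hd : Disjoint (sl V j σ) (V \ sl V j σ) := Finset.disjoint_sdiff
  have hL := lift_GC hGC (Z := V \ sl V j σ) (by rw [← hVe]; exact hV) hd
  rw [← hVe] at hL
  obtain ⟨v, hv⟩ := nonempty_of_Eqv (hGC.eqv hXc) hne
  have hv0 := hv
  simp only [sh, Finset.mem_image] at hv
  obtain ⟨y, hy, rfl⟩ := hv
  rw [mem_sl] at hy
  have hy' : Function.update (Function.update y j σ) j (c (Function.update y j σ j)) = y := by
    rw [Function.update_self, Function.update_idem, ← hy.2, Function.update_eq_self]
  have hyZ : y ∈ V \ sl V j σ := by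
    rw [Finset.mem_sdiff, mem_sl]
    refine ⟨hy.1, fun h => ?_⟩
    rw [hy.2] at h
    exact cne (c := c) _ h.2
  have m1 : Function.update y j σ ∈ sh (sl V j (c σ)) j σ ∪ (V \ sl V j σ) :=
    Finset.mem_union_left _ hv0
  have m2 : Function.update (Function.update y j σ) j (c (Function.update y j σ j)) ∈
      sh (sl V j (c σ)) j σ ∪ (V \ sl V j σ) := by
    rw [hy']
    exact Finset.mem_union_right _ hyZ
  have hst := step_mk (c := c) m1 m2 τ
  have hps := F0 hφ m1 m2 (by simpa using h1) h2
  refine ⟨_, Relation.ReflTransGen.tail (hL.mono ?_) ⟨hst, ?_⟩, lt_of_lt_of_le hps ?_⟩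
  · intro w hw
    simp only [Finset.mem_filter] at hw
    rw [Finset.mem_sdiff, mem_sl]
    exact ⟨hw.1, fun h => hw.2.1 h.2⟩
  · intro w hw
    simp only [Finset.mem_filter] at hw
    rw [hy']
    apply Finset.mem_union_left
    rw [Finset.mem_sdiff]
    refine ⟨Finset.mem_union_right _ (by rw [Finset.mem_sdiff, mem_sl]; exact ⟨hw.1, fun h => hw.2.1 h.2⟩), ?_⟩
    simp only [Finset.mem_insert, Finset.mem_singleton]
    rintro (h | h)
    · apply hw.2.1
      rw [h]
      simp
    · apply hw.2.2
      rw [h, hy.2]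
  · have e0 : Psi φ (sh (sl V j (c σ)) j σ) = Psi φ (sl V j (c σ)) := by
      unfold Psi sh
      rw [Finset.sum_image (sh_inj V j (c σ) σ)]
      apply Finset.sum_congr rfl
      intro w hw
      have := wt_update φ w j σ
      rw [(mem_sl.1 hw).2, hφ] at this
      omega
    have e1 := Psi_union_le φ (sh (sl V j (c σ)) j σ) (V \ sl V j σ)
    have e2 : Psi φ V = Psi φ (V \ sl V j σ) + Psi φ (sl V j σ) := by
      unfold Psi
      rw [← Finset.sum_sdiff (sl_sub V j σ)]
    omega

/-- relative partition: inside the box of v, the code C partitions the box of x -/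
structure Part (c : S → S) (v x : Fin d → S) (C : Finset (Fin d → S)) : Prop where
  code : IsCode c C
  nd : ∀ w ∈ C, ¬ Dich c w v
  xnd : ¬ Dich c x v
  cov : ∀ p : Fin d → Pt c, InB p v → (Cov p C ↔ InB p x)

/-- existence of a twin -/
def HasTwin (c : S → S) (C : Finset (Fin d → S)) : Prop :=
  ∃ w ∈ C, ∃ j, Function.update w j (c (w j)) ∈ C

theorem HasTwin.mono {C D : Finset (Fin d → S)} (h : HasTwin c C) (hs : C ⊆ D) : HasTwin c D := by
  obtain ⟨w, hw, j, h⟩ := h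
  exact ⟨w, hs hw, j, hs h⟩

theorem sub_rel {v w x : Fin d → S} (hw : ¬ Dich c w v)
    (h : ∀ p : Fin d → Pt c, InB p v → InB p w → InB p x) (i : Fin d) :
    x i = v i ∨ x i = w i := by
  by_contra hn
  push Not at hn
  have : ∀ k, ∃ f : Pt c, f.1 (w k) = true ∧ f.1 (v k) = true ∧ (k = i → f.1 (x i) = false) := by
    intro k
    by_cases hk : k = i
    · subst hk
      obtain ⟨f, h1, h2, h3⟩ := exists_pt3 (c := c) (s := w k) (t := v k) (u := x k)
        (fun h => hw ⟨k, h⟩) hn.2 hn.1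
      exact ⟨f, h1, h2, fun _ => h3⟩
    · obtain ⟨f, h1, h2⟩ := exists_pt2 (c := c) (s := w k) (t := v k) (fun h => hw ⟨k, h⟩)
      exact ⟨f, h1, h2, fun h => absurd h hk⟩
  choose p hp using this
  have h1 := h p (fun k => (hp k).2.1) (fun k => (hp k).1) i
  rw [(hp i).2.2 rfl] at h1
  simp at h1

namespace Part

variable {v x : Fin d → S} {C : Finset (Fin d → S)}

theorem sub (h : Part c v x C) {w : Fin d → S} (hw : w ∈ C) (i : Fin d) :
    x i = v i ∨ x i = w i :=
  sub_rel (h.nd w hw) (fun p hv hpw => (h.cov p hv).1 ⟨w, hw, hpw⟩) i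

theorem ne_c (h : Part c v x C) {w : Fin d → S} (hw : w ∈ C) (i : Fin d) : w i ≠ c (v i) :=
  fun h' => h.nd w hw ⟨i, h'⟩

theorem single (h : Part c v x C) {w : Fin d → S} (hC : C = {w}) : w = x := by
  have hw : w ∈ C := by simp [hC]
  funext i
  have h1 := h.sub hw i
  have h2 := sub_rel (x := w) h.xnd (fun p hv hpx => by
    obtain ⟨w', hw', hp⟩ := (h.cov p hv).2 hpx
    rw [hC, Finset.mem_singleton] at hw'
    rwa [hw'] at hp) i
  rcases h1 with h1 | h1
  · rcases h2 with h2 | h2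
    · rw [h1, h2]
    · exact h2
  · exact h1.symm

theorem nonempty (h : Part c v x C) : C.Nonempty := by
  obtain ⟨p, h1, h2⟩ := exists_InB2 h.xnd
  obtain ⟨w, hw, _⟩ := (h.cov p h2).2 h1
  exact ⟨w, hw⟩

theorem volume (h : Part c v x C) : ∑ w ∈ C, 2 ^ (zz v w) = 2 ^ (zz v x) := by
  have e : bx c v ∩ bx c x = C.biUnion (fun w => bx c v ∩ bx c w) := by
    ext p
    simp only [Finset.mem_inter, Finset.mem_biUnion, mem_bx]
    constructor
    · rintro ⟨h1, h2⟩
      obtain ⟨w, hw, hp⟩ := (h.cov p h1).2 h2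
      exact ⟨w, hw, h1, hp⟩
    · rintro ⟨w, hw, h1, hp⟩
      exact ⟨h1, (h.cov p h1).1 ⟨w, hw, hp⟩⟩
  have e1 : (bx c v ∩ bx c x).card = ∑ w ∈ C, (bx c v ∩ bx c w).card := by
    rw [e, Finset.card_biUnion]
    intro w hw w' hw' hne
    exact Finset.disjoint_of_subset_left Finset.inter_subset_right
      (Finset.disjoint_of_subset_right Finset.inter_subset_right (bx_disj h.code hw hw' hne))
  have e2 := card_bx_inter h.xnd
  rw [e1, Finset.sum_mul, Finset.sum_congr rfl (fun w hw => card_bx_inter (h.nd w hw)),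
    ← Finset.mul_sum] at e2
  have := card_Pt_pos (c := c)
  exact Nat.eq_of_mul_eq_mul_left (by positivity) e2

theorem S1 (h : Part c v x C) {j : Fin d} {a : S} (hx : x j = v j) (h1 : v j ≠ a) (h2 : v j ≠ c a)
    {p : Fin d → Pt c} (hp : InB p v) (hC : Cov p (sl C j a)) : Cov (flp p j a) (sl C j (c a)) := by
  obtain ⟨w, hw, hpw⟩ := hC
  rw [mem_sl] at hw
  have hpx := (h.cov p hp).1 ⟨w, hw.1, hpw⟩
  have hpx' := (InB_flp_of_ne (p := p) (hx ▸ h1) (hx ▸ h2)).2 hpx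
  have hpv' := (InB_flp_of_ne (p := p) h1 h2).2 hp
  obtain ⟨w', hw', hpw'⟩ := (h.cov _ hpv').2 hpx'
  by_cases k1 : w' j = a
  · have e1 := InB_j hpw hw.2
    have e2 := InB_j hpw' k1
    rw [flp_j, e1] at e2
    simp at e2
  · by_cases k2 : w' j = c a
    · exact ⟨w', mem_sl.2 ⟨hw', k2⟩, hpw'⟩
    · have := code_uniq h.code hw' hw.1 ((InB_flp_of_ne k1 k2).1 hpw') hpw
      exact absurd (this ▸ hw.2) k1

theorem S2 (h : Part c v x C) {j : Fin d} {a : S} (hx : x j = v j) (h1 : v j ≠ a) (h2 : v j ≠ c a)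
    {w : Fin d → S} (hw : sl C j a = {w}) :
    Part c v (Function.update w j (c a)) (sl C j (c a)) := by
  have hwC : w ∈ sl C j a := by simp [hw]
  rw [mem_sl] at hwC
  refine ⟨h.code.mono (sl_sub _ _ _), fun y hy => h.nd y (sl_sub _ _ _ hy), ?_, ?_⟩
  · rintro ⟨i, hi⟩
    by_cases hij : i = j
    · subst hij
      rw [Function.update_self] at hi
      exact h1 (cinj hi).symm
    · rw [Function.update_of_ne hij] at hi
      exact h.nd w hwC.1 ⟨i, hi⟩
  · intro p hp
    have hpv' := (InB_flp_of_ne (p := p) h1 h2).2 hp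
    rw [← InB_flp_update hwC.2]
    constructor
    · intro hC
      have := h.S1 hx h2 (by rwa [cc (c := c)]) hp hC
      rw [flp_c, cc (c := c), hw] at this
      obtain ⟨w', hw', hp'⟩ := this
      rw [Finset.mem_singleton] at hw'
      rwa [hw'] at hp'
    · intro hpw
      have := h.S1 hx h1 h2 hpv' ⟨w, mem_sl.2 hwC, hpw⟩
      rwa [flp_flp] at this

theorem S3 (h : Part c v x C) {j : Fin d} {a : S} (hx : x j = v j) (h1 : v j ≠ a) (h2 : v j ≠ c a)
    (hC : ∀ w ∈ C, w j = a ∨ w j = c a) : Part c v (Function.update x j a) (sl C j a) := by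
  refine ⟨h.code.mono (sl_sub _ _ _), fun y hy => h.nd y (sl_sub _ _ _ hy), ?_, ?_⟩
  · rintro ⟨i, hi⟩
    by_cases hij : i = j
    · subst hij
      rw [Function.update_self] at hi
      exact h2 (ceq hi)
    · rw [Function.update_of_ne hij] at hi
      exact h.xnd ⟨i, hi⟩
  · intro p hp
    constructor
    · rintro ⟨w, hw, hpw⟩
      rw [mem_sl] at hw
      have := (h.cov p hp).1 ⟨w, hw.1, hpw⟩
      intro i
      by_cases hij : i = j
      · subst hij
        rw [Function.update_self, ← hw.2]
        exact hpw i
      · rw [Function.update_of_ne hij]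
        exact this i
    · intro hpx
      have hpx' : InB p x := by
        intro i
        by_cases hij : i = j
        · rw [hij, hx]; exact hp j
        · have := hpx i
          rwa [Function.update_of_ne hij] at this
      obtain ⟨w, hw, hpw⟩ := (h.cov p hp).2 hpx'
      rcases hC w hw with k | k
      · exact ⟨w, mem_sl.2 ⟨hw, k⟩, hpw⟩
      · have e1 := hpx j
        rw [Function.update_self] at e1
        have := InB_jc hpw k
        simp [e1] at this

/-- two dichotomous words: consequences -/
theorem pos (h : Part c v x C) {w w' : Fin d → S} (hw : w ∈ C) (hw' : w' ∈ C) {j : Fin d}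
    (hj : w' j = c (w j)) : x j = v j ∧ v j ≠ w j ∧ v j ≠ c (w j) := by
  refine ⟨?_, ?_, ?_⟩
  · rcases h.sub hw j with k | k
    · exact k
    · rcases h.sub hw' j with k' | k'
      · exact k'
      · rw [k, hj] at k'
        exact absurd k'.symm (cne (c := c) _)
  · intro k
    apply h.ne_c hw' j
    rw [hj, k]
  · intro k
    exact h.ne_c hw j (ceq k)

theorem T4 (n : ℕ) : ∀ (x : Fin d → S) (C : Finset (Fin d → S)), Part c v x C → C.card = n →
    2 ≤ n → n ≤ 4 → HasTwin c C := by
  induction n using Nat.strong_induction_on with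
  | _ n ih =>
    intro x C h hn h2 h4
    have hmain : ∀ (a : S) (j : Fin d), x j = v j → v j ≠ a → v j ≠ c a → (sl C j a).card = 1 →
        1 ≤ (sl C j (c a)).card → (sl C j (c a)).card < n → HasTwin c C := by
      intro a j hx h1 h2' hc1 hc2 hc3
      obtain ⟨w, hw⟩ := Finset.card_eq_one.1 hc1
      have hwC : w ∈ sl C j a := by simp [hw]
      have hP := h.S2 hx h1 h2' hw
      rcases Nat.lt_or_ge (sl C j (c a)).card 2 with hl | hl
      · obtain ⟨y, hy⟩ := Finset.card_eq_one.1 (show (sl C j (c a)).card = 1 by omega)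
        have := hP.single hy
        have hyC : y ∈ sl C j (c a) := by simp [hy]
        refine ⟨w, (mem_sl.1 hwC).1, j, ?_⟩
        rw [(mem_sl.1 hwC).2, ← this]
        exact (mem_sl.1 hyC).1
      · exact (ih _ hc3 _ _ hP rfl hl (by omega)).mono (sl_sub _ _ _)
    obtain ⟨w1, hw1, w2, hw2, hne⟩ := Finset.one_lt_card.1 (show 1 < C.card by omega)
    obtain ⟨j, hj⟩ := dich_symm (h.code w1 hw1 w2 hw2 hne)
    obtain ⟨hx, k1, k2⟩ := h.pos hw1 hw2 hj
    have n1 : 1 ≤ (sl C j (w1 j)).card := Finset.card_pos.2 ⟨w1, mem_sl.2 ⟨hw1, rfl⟩⟩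
    have n2 : 1 ≤ (sl C j (c (w1 j))).card := Finset.card_pos.2 ⟨w2, mem_sl.2 ⟨hw2, hj⟩⟩
    have hdis : Disjoint (sl C j (w1 j)) (sl C j (c (w1 j))) := by
      rw [Finset.disjoint_left]
      intro y hy hy'
      rw [mem_sl] at hy hy'
      exact cne (c := c) _ (hy'.2.symm.trans hy.2)
    have hsub : sl C j (w1 j) ∪ sl C j (c (w1 j)) ⊆ C := Finset.union_subset (sl_sub _ _ _) (sl_sub _ _ _)
    have hcard : (sl C j (w1 j)).card + (sl C j (c (w1 j))).card ≤ n := by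
      rw [← Finset.card_union_of_disjoint hdis, ← hn]
      exact Finset.card_le_card hsub
    rcases Nat.eq_or_lt_of_le n1 with e1 | e1
    · exact hmain (w1 j) j hx k1 k2 e1.symm n2 (by omega)
    · rcases Nat.eq_or_lt_of_le n2 with e2 | e2
      · exact hmain (c (w1 j)) j hx k2 (by rwa [cc (c := c)]) e2.symm (by rw [cc (c := c)]; omega)
          (by rw [cc (c := c)]; omega)
      · have hall : sl C j (w1 j) ∪ sl C j (c (w1 j)) = C := by
          apply Finset.eq_of_subset_of_card_le hsub
          rw [Finset.card_union_of_disjoint hdis]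
          omega
        have hP := h.S3 hx k1 k2 (by
          intro w hw
          rw [← hall, Finset.mem_union, mem_sl, mem_sl] at hw
          exact hw.imp And.right And.right)
        exact (ih _ (by omega) _ _ hP rfl (by omega) (by omega)).mono (sl_sub _ _ _)

theorem five_le (h : Part c v x C) (ht : ¬ HasTwin c C) (h1 : C.card ≠ 1) : 5 ≤ C.card := by
  by_contra hlt
  have := Finset.card_pos.2 h.nonempty
  exact ht (T4 _ _ _ h rfl (by omega) (by omega))

theorem P1 (h : Part c v x C) {w : Fin d → S} (hw : w ∈ C) {j : Fin d} (hx : x j = v j)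
    (hj : w j ≠ v j) : (sl C j (c (w j))).Nonempty := by
  obtain ⟨p, h1, h2⟩ := exists_InB2 (h.nd w hw)
  obtain ⟨y, hy, _⟩ := h.S1 hx hj.symm (fun k => h.ne_c hw j (ceq k)) h2 ⟨w, mem_sl.2 ⟨hw, rfl⟩, h1⟩
  exact ⟨y, hy⟩

theorem P2 (h : Part c v x C) (ht : ¬ HasTwin c C) {w : Fin d → S} (hw : w ∈ C) {j : Fin d}
    (hx : x j = v j) (hj : w j ≠ v j) (h1 : (sl C j (w j)).card = 1) :
    5 ≤ (sl C j (c (w j))).card := by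
  obtain ⟨y, hy⟩ := Finset.card_eq_one.1 h1
  have hwy : w ∈ sl C j (w j) := mem_sl.2 ⟨hw, rfl⟩
  have : w = y := by rwa [hy, Finset.mem_singleton] at hwy
  subst this
  have hP := h.S2 hx hj.symm (fun k => h.ne_c hw j (ceq k)) hy
  apply hP.five_le (fun h => ht (h.mono (sl_sub _ _ _)))
  intro e
  obtain ⟨z, hz⟩ := Finset.card_eq_one.1 e
  have := hP.single hz
  have hzC : z ∈ sl C j (c (w j)) := by simp [hz]
  exact ht ⟨w, hw, j, this ▸ (mem_sl.1 hzC).1⟩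

theorem P3 (h : Part c v x C) (ht : ¬ HasTwin c C) {w : Fin d → S} (hw : w ∈ C) {j : Fin d}
    (hx : x j = v j) (hj : w j ≠ v j) (hC : ∀ y ∈ C, y j = w j ∨ y j = c (w j)) :
    (sl C j (w j)).card = 1 ∨ 5 ≤ (sl C j (w j)).card := by
  have hP := h.S3 hx hj.symm (fun k => h.ne_c hw j (ceq k)) hC
  by_cases e : (sl C j (w j)).card = 1
  · exact Or.inl e
  · exact Or.inr (hP.five_le (fun h => ht (h.mono (sl_sub _ _ _))) e)

theorem card_sub (h : Part c v x C) {w : Fin d → S} (hw : w ∈ C) :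
    C.card ≤ 1 + ∑ i ∈ Finset.univ.filter (fun i => w i ≠ v i), (sl C i (c (w i))).card := by
  have : C.erase w ⊆ (Finset.univ.filter (fun i => w i ≠ v i)).biUnion (fun i => sl C i (c (w i))) := by
    intro y hy
    rw [Finset.mem_erase] at hy
    obtain ⟨i, hi⟩ := h.code y hy.2 w hw hy.1
    rw [Finset.mem_biUnion]
    refine ⟨i, ?_, mem_sl.2 ⟨hy.2, hi⟩⟩
    simp only [Finset.mem_filter, Finset.mem_univ, true_and]
    intro k
    exact h.ne_c hy.2 i (by rw [hi, k])
  have h1 := Finset.card_le_card this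
  have h2 := Finset.card_biUnion_le (s := Finset.univ.filter (fun i => w i ≠ v i))
    (t := fun i => sl C i (c (w i)))
  have h3 := Finset.card_erase_add_one hw
  omega

end Part

/-- words compatible with v -/
def ndw (c : S → S) (B : Finset (Fin d → S)) (v : Fin d → S) : Finset (Fin d → S) :=
  B.filter (fun w => ¬ Dich c w v)

theorem mem_ndw {B : Finset (Fin d → S)} {v w : Fin d → S} :
    w ∈ ndw c B v ↔ w ∈ B ∧ ¬ Dich c w v := by simp [ndw]

theorem ndw_sub (B : Finset (Fin d → S)) (v : Fin d → S) : ndw c B v ⊆ B :=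
  Finset.filter_subset _ _

theorem Part_ndw {B : Finset (Fin d → S)} {v : Fin d → S} (hB : IsCode c B)
    (h : ∀ p : Fin d → Pt c, InB p v → Cov p B) : Part c v v (ndw c B v) := by
  refine ⟨hB.mono (ndw_sub _ _), fun w hw => (mem_ndw.1 hw).2, not_dich_self _, ?_⟩
  intro p hp
  refine ⟨fun _ => hp, fun _ => ?_⟩
  obtain ⟨w, hw, hpw⟩ := h p hp
  exact ⟨w, mem_ndw.2 ⟨hw, not_dich_of_InB hpw hp⟩, hpw⟩

/-- local statement -/
def LL (c : S → S) (J : Finset (Fin d)) (M : ℕ) : Prop :=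
  ∀ (r : Fin d → S) (A B : Finset (Fin d → S)), CO r J A → IsCode c A → IsCode c B →
    Eqv c A B → A.card ≤ M → GC c A B

theorem slice_eqv {A V : Finset (Fin d → S)} (hA : IsCode c A) (hV : IsCode c V)
    (hE : Eqv c A V) {j : Fin d} {σ : S} (h1 : ∀ u ∈ A, u j ≠ σ) (h2 : ∀ u ∈ A, u j ≠ c σ) :
    Eqv c (sl V j σ) (sh (sl V j (c σ)) j σ) := by
  have := (slice_lemma hA hV hE h2).1
  have e : sl A j σ = ∅ := by
    rw [Finset.eq_empty_iff_forall_notMem]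
    intro u hu
    rw [mem_sl] at hu
    exact h1 u hu.1 hu.2
  rwa [e, Finset.empty_union] at this

theorem F2 {A V : Finset (Fin d → S)} (hA : IsCode c A) (hV : IsCode c V)
    (hE : Eqv c A V) {j : Fin d} {σ τ : S} (h1 : ∀ u ∈ A, u j ≠ σ) (h2 : ∀ u ∈ A, u j ≠ c σ)
    {φ : Fin d → S → ℕ} (hφ : ∀ i s, φ i (c s) = φ i s) (p1 : 0 < φ j σ) (p2 : φ j τ = 0)
    (hne : (sl V j σ).Nonempty) (g1 : GC c (sl V j σ) (sh (sl V j (c σ)) j σ))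
    (g2 : GC c (sl V j (c σ)) (sh (sl V j σ) j (c σ))) :
    ∃ V', GCFix c (V.filter (fun w => w j ≠ σ ∧ w j ≠ c σ)) V V' ∧ Psi φ V' < Psi φ V := by
  rcases le_total (Psi φ (sl V j (c σ))) (Psi φ (sl V j σ)) with hle | hle
  · exact F1 hV hφ g1 hne p1 p2 hle
  · have hne' : (sl V j (c σ)).Nonempty := by
      obtain ⟨y, hy⟩ := nonempty_of_Eqv (slice_eqv hA hV hE h1 h2) hne
      simp only [sh, Finset.mem_image] at hy
      obtain ⟨z, hz, _⟩ := hy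
      exact ⟨z, hz⟩
    obtain ⟨V', k1, k2⟩ := F1 hV hφ (σ := c σ) (τ := τ) (by rwa [cc (c := c)]) hne'
      (by rwa [hφ]) p2 (by rwa [cc (c := c)])
    refine ⟨V', ?_, k2⟩
    rw [cc (c := c)] at k1
    apply k1.mono
    intro w hw
    simp only [Finset.mem_filter] at hw ⊢
    exact ⟨hw.1, hw.2.2, hw.2.1⟩

theorem CO_sl {r : Fin d → S} {J : Finset (Fin d)} {A : Finset (Fin d → S)} (h : CO r J A)
    (j : Fin d) (σ : S) : CO (Function.update r j σ) (J.erase j) (sl A j σ) := by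
  intro w hw i hi
  rw [mem_sl] at hw
  by_cases hij : i = j
  · rw [hij, Function.update_self, hw.2]
  · rw [Function.update_of_ne hij]
    apply h w hw.1
    intro h'
    exact hi (Finset.mem_erase.2 ⟨hij, h'⟩)

theorem common_word {A B : Finset (Fin d → S)} {r : Fin d → S} {J : Finset (Fin d)}
    (IH : ∀ A' B', CO r J A' → IsCode c A' → IsCode c B' → Eqv c A' B' → A'.card < A.card →
      GC c A' B')
    (hA : IsCode c A) (hB : IsCode c B) (hr : CO r J A) (hE : Eqv c A B) {u : Fin d → S}
    (h1 : u ∈ A) (h2 : u ∈ B) : GC c A B := by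
  have eA : A = A.erase u ∪ {u} := by
    rw [Finset.union_comm, ← Finset.insert_eq, Finset.insert_erase h1]
  have eB : B = B.erase u ∪ {u} := by
    rw [Finset.union_comm, ← Finset.insert_eq, Finset.insert_erase h2]
  have dA : Disjoint (A.erase u) {u} := by simp
  have dB : Disjoint (B.erase u) {u} := by simp
  have hE' := Eqv_of_union (by rw [← eA]; exact hA) (by rw [← eB]; exact hB) dA dB
    (by rw [← eA, ← eB]; exact hE)
  have := IH (A.erase u) (B.erase u) (fun w hw => hr w (Finset.mem_of_mem_erase hw))
    (hA.mono (Finset.erase_subset _ _)) (hB.mono (Finset.erase_subset _ _)) hE'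
    (Finset.card_erase_lt_of_mem h1)
  have := (lift_GC this (Z := {u}) (by rw [← eA]; exact hA) dA).gc
  rwa [← eA, ← eB] at this

theorem min_lemma {A B : Finset (Fin d → S)} {r : Fin d → S} {J : Finset (Fin d)}
    (hJ : ∀ j ∈ J, ∀ M, LL c (J.erase j) M)
    (IH : ∀ A' B', CO r J A' → IsCode c A' → IsCode c B' → Eqv c A' B' → A'.card < A.card →
      GC c A' B')
    (hA : IsCode c A) (hB : IsCode c B) (hr : CO r J A) (hE : Eqv c A B) (hn : ¬ GC c A B) :
    ∃ B2 v, IsCode c B2 ∧ Eqv c A B2 ∧ v ∈ A ∧ Disjoint A B2 ∧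
      (∀ j ∈ J, ∀ w ∈ B2, ∃ u ∈ A, u j = c (w j)) ∧ ¬ HasTwin c (ndw c B2 v) ∧
      (∀ j ∈ J, ∀ w ∈ B2, (sl B2 j (w j)).card + (ndw c B2 v).card ≤ A.card) := by
  classical
  have hAne : A.Nonempty := by
    by_contra h
    rw [Finset.not_nonempty_iff_eq_empty] at h
    have : B = ∅ := by
      rw [← Finset.not_nonempty_iff_eq_empty]
      intro hB
      obtain ⟨x, hx⟩ := nonempty_of_Eqv hE.symm hB
      simp [h] at hx
    rw [h, this] at hn
    exact hn (GC.refl _)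
  obtain ⟨u0, hu0⟩ := hAne
  set φ : Fin d → S → ℕ := fun i s => if ∃ u ∈ A, u i = s ∨ u i = c s then 0 else 1 with hφd
  have hφ : ∀ i s, φ i (c s) = φ i s := by
    intro i s
    have : (∃ u ∈ A, u i = c s ∨ u i = c (c s)) ↔ (∃ u ∈ A, u i = s ∨ u i = c s) := by
      simp only [cc (c := c), or_comm]
    simp only [hφd, this]
  have hφ0 : ∀ i, ∀ u ∈ A, φ i (u i) = 0 := by
    intro i u hu
    simp only [hφd]
    rw [if_pos ⟨u, hu, Or.inl rfl⟩]
  let μ : Finset (Fin d → S) → (Fin d → S) → ℕ := fun B' v =>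
    Psi φ B' * (A.card + 1) + (ndw c B' v).card
  have hex : ∃ n, ∃ B' v, GC c B B' ∧ v ∈ A ∧ μ B' v = n := ⟨_, B, u0, GC.refl _, hu0, rfl⟩
  obtain ⟨B2, v, hG, hv, hμ⟩ := Nat.find_spec hex
  have hmin : ∀ B' v', GC c B2 B' → v' ∈ A → μ B2 v ≤ μ B' v' := by
    intro B' v' h1 h2
    rw [hμ]
    exact Nat.find_min' hex ⟨B', v', hG.trans h1, h2, rfl⟩
  have hB2 := hG.code hB
  have hE2 : Eqv c A B2 := hE.trans (hG.eqv hB)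
  have hcard : ∀ B', GC c B2 B' → B'.card = A.card := by
    intro B' h
    exact (card_eq_of_Eqv hA (h.code hB2) (hE2.trans (h.eqv hB2))).symm
  have hM1 : ∀ B', GC c B2 B' → Disjoint A B' := by
    intro B' h
    rw [Finset.disjoint_left]
    intro u h1 h2
    have := common_word IH hA (h.code hB2) hr (hE2.trans (h.eqv hB2)) h1 h2
    exact hn (this.trans ((hG.trans h).symm hB))
  have hPsi : ∀ B', GC c B2 B' → Psi φ B2 ≤ Psi φ B' := by
    intro B' h
    by_contra hlt
    push Not at hlt
    have h1 := hmin B' v h hv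
    have h2 : (ndw c B' v).card ≤ A.card := by
      rw [← hcard B' h]
      exact Finset.card_le_card (ndw_sub _ _)
    obtain ⟨k, hk⟩ := Nat.exists_eq_add_of_lt hlt
    simp only [μ] at h1
    rw [hk] at h1
    nlinarith
  have hM4 : ∀ v2 ∈ A, (ndw c B2 v).card ≤ (ndw c B2 v2).card := by
    intro v2 h2
    have := hmin B2 v2 (GC.refl _) h2
    simp only [μ] at this
    omega
  have hrB2 := CO_of_Eqv hr hE2
  have hM2 : ∀ j ∈ J, ∀ w ∈ B2, ∃ u ∈ A, u j = c (w j) := by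
    intro j hj w hw
    by_contra hno
    push Not at hno
    obtain ⟨e1, e2⟩ := slice_lemma hA hB2 hE2 hno
    have g := hJ j hj _ _ _ _ (CO_sl hrB2 j (w j)) (hB2.mono (sl_sub _ _ _)) e2 e1 le_rfl
    by_cases hs : (sl A j (w j)).Nonempty
    · obtain ⟨u, hu⟩ := hs
      have hVe : B2 = sl B2 j (w j) ∪ (B2 \ sl B2 j (w j)) :=
        (Finset.union_sdiff_of_subset (sl_sub _ _ _)).symm
      have hL := (lift_GC g (Z := B2 \ sl B2 j (w j)) (by rw [← hVe]; exact hB2)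
        Finset.disjoint_sdiff).gc
      rw [← hVe] at hL
      exact Finset.disjoint_left.1 (hM1 _ hL) (mem_sl.1 hu).1
        (Finset.mem_union_left _ (Finset.mem_union_left _ hu))
    · have hno' : ∀ u ∈ A, u j ≠ w j := fun u hu h => hs ⟨u, mem_sl.2 ⟨hu, h⟩⟩
      rw [Finset.not_nonempty_iff_eq_empty] at hs
      rw [hs, Finset.empty_union] at g
      have e3 := slice_eqv hA hB2 hE2 (σ := c (w j)) hno (by rwa [cc (c := c)])
      have g' := hJ j hj _ _ _ _ (CO_sl hrB2 j (c (w j))) (hB2.mono (sl_sub _ _ _))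
        (sh_code hB2 _ _ _) e3 le_rfl
      rw [cc (c := c)] at g'
      have p1 : 0 < φ j (w j) := by
        simp only [hφd]
        rw [if_neg]
        · exact one_pos
        · rintro ⟨u, hu, h | h⟩
          · exact hno' u hu h
          · exact hno u hu h
      obtain ⟨V', k1, k2⟩ := F2 hA hB2 hE2 hno' hno hφ p1 (hφ0 j u0 hu0)
        ⟨w, mem_sl.2 ⟨hw, rfl⟩⟩ g g'
      have := hPsi V' k1.gc
      omega
  refine ⟨B2, v, hB2, hE2, hv, hM1 _ (GC.refl _), hM2, ?_, ?_⟩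
  · rintro ⟨w, hw, j, hw'⟩
    have m1 := (mem_ndw.1 hw)
    have m2 := (mem_ndw.1 hw')
    have hst := GC.single (step_mk m1.1 m2.1 (v j))
    have hp := F00 hφ m1.1 m2.1 (τ := v j)
    rw [hφ0 j v hv] at hp
    have hmm := hmin _ v hst hv
    have hwne : w ≠ Function.update w j (c (w j)) := by
      intro h
      have := congrFun h j
      rw [Function.update_self] at this
      exact cne (c := c) _ this.symm
    set C := ndw c B2 v
    set B3 := (B2 \ {w, Function.update w j (c (w j))}) ∪
      {Function.update w j (v j), Function.update w j (c (v j))}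
    have hsub : ndw c B3 v ⊆ insert (Function.update w j (v j))
        (C \ {w, Function.update w j (c (w j))}) := by
      intro y hy
      rw [mem_ndw] at hy
      rw [Finset.mem_insert, Finset.mem_sdiff]
      rcases Finset.mem_union.1 hy.1 with h | h
      · rw [Finset.mem_sdiff] at h
        exact Or.inr ⟨mem_ndw.2 ⟨h.1, hy.2⟩, h.2⟩
      · simp only [Finset.mem_insert, Finset.mem_singleton] at h
        rcases h with h | h
        · exact Or.inl h
        · exact absurd ⟨j, by rw [h]; simp⟩ hy.2
    have hc1 := Finset.card_le_card hsub
    have hc2 := Finset.card_insert_le (Function.update w j (v j))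
      (C \ {w, Function.update w j (c (w j))})
    have hc3 : (C \ {w, Function.update w j (c (w j))}).card + 2 = C.card := by
      rw [← Finset.card_pair hwne]
      apply Finset.card_sdiff_add_card_eq_card
      intro x hx
      simp only [Finset.mem_insert, Finset.mem_singleton] at hx
      rcases hx with rfl | rfl <;> assumption
    simp only [μ] at hmm
    have hpp : Psi φ B3 ≤ Psi φ B2 := by omega
    have := Nat.mul_le_mul_right (A.card + 1) hpp
    have e : (ndw c B2 v).card = C.card := rfl
    omega
  · intro j hj w hw
    obtain ⟨u, hu, huj⟩ := hM2 j hj w hw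
    have h4 := hM4 u hu
    have hd : Disjoint (sl B2 j (w j)) (ndw c B2 u) := by
      rw [Finset.disjoint_left]
      intro y h1 h2
      apply (mem_ndw.1 h2).2
      refine ⟨j, ?_⟩
      rw [(mem_sl.1 h1).2, huj, cc (c := c)]
    have := Finset.card_le_card (Finset.union_subset (sl_sub B2 j (w j)) (ndw_sub (c := c) B2 u))
    rw [Finset.card_union_of_disjoint hd, hcard B2 (GC.refl _)] at this
    omega

/-- minimal counterexample data -/
structure Bad (c : S → S) (J : Finset (Fin d)) (r : Fin d → S) (A B : Finset (Fin d → S))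
    (v : Fin d → S) : Prop where
  codeA : IsCode c A
  codeB : IsCode c B
  coA : CO r J A
  coB : CO r J B
  eqv : Eqv c A B
  vA : v ∈ A
  disj : Disjoint A B
  nt : ¬ HasTwin c (ndw c B v)
  slb : ∀ j ∈ J, ∀ w ∈ B, (sl B j (w j)).card + (ndw c B v).card ≤ A.card
  part : Part c v v (ndw c B v)

theorem LL_of {J : Finset (Fin d)} (hJ : ∀ j ∈ J, ∀ M, LL c (J.erase j) M) (M : ℕ)
    (key : ∀ r A B v, Bad c J r A B v → A.card ≤ M → False) : LL c J M := by
  have : ∀ m, ∀ (r : Fin d → S) (A B : Finset (Fin d → S)), CO r J A → IsCode c A → IsCode c B →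
      Eqv c A B → A.card ≤ M → A.card = m → GC c A B := by
    intro m
    induction m using Nat.strong_induction_on with
    | _ m ih =>
      intro r A B hr hA hB hE hM hm
      by_contra hn
      obtain ⟨B2, v, h1, h2, h3, h4, h5, h6, h7⟩ := min_lemma hJ
        (fun A' B' a1 a2 a3 a4 a5 => ih A'.card (by omega) r A' B' a1 a2 a3 a4 (by omega) rfl)
        hA hB hr hE hn
      refine key r A B2 v ⟨hA, h1, hr, CO_of_Eqv hr h2, h2, h3, h4, h6, h7, ?_⟩ hM
      exact Part_ndw h1 (fun p hp => (h2 p).1 ⟨v, h3, hp⟩)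
  intro r A B hr hA hB hE hM
  exact this _ r A B hr hA hB hE hM rfl

namespace Bad

variable {J : Finset (Fin d)} {r : Fin d → S} {A B : Finset (Fin d → S)} {v : Fin d → S}

theorem five (h : Bad c J r A B v) : 5 ≤ (ndw c B v).card := by
  apply h.part.five_le h.nt
  intro e
  obtain ⟨w, hw⟩ := Finset.card_eq_one.1 e
  have := h.part.single hw
  have hwC : w ∈ ndw c B v := by simp [hw]
  rw [this] at hwC
  exact Finset.disjoint_left.1 h.disj h.vA (mem_ndw.1 hwC).1

theorem off (h : Bad c J r A B v) {w : Fin d → S} (hw : w ∈ B) {i : Fin d} (hi : w i ≠ v i) :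
    i ∈ J := by
  by_contra hn
  rw [h.coB w hw i hn, h.coA v h.vA i hn] at hi
  exact hi rfl

theorem le_pow (h : Bad c J r A B v) : (ndw c B v).card ≤ 2 ^ J.card :=
  card_le_of_CO h.part.code (fun w hw => h.coB w (mem_ndw.1 hw).1)

theorem sl_le (h : Bad c J r A B v) {j : Fin d} (hj : j ∈ J) {w : Fin d → S}
    (hw : w ∈ ndw c B v) : (sl (ndw c B v) j (w j)).card + (ndw c B v).card ≤ A.card := by
  have h1 := h.slb j hj w (mem_ndw.1 hw).1
  have h2 : (sl (ndw c B v) j (w j)).card ≤ (sl B j (w j)).card := by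
    apply Finset.card_le_card
    intro y hy
    rw [mem_sl] at hy ⊢
    exact ⟨(mem_ndw.1 hy.1).1, hy.2⟩
  omega

/-- complementary letters occur at least twice -/
theorem two_le (h : Bad c J r A B v) (hm : A.card ≤ 9) {j : Fin d} (hj : j ∈ J) {w : Fin d → S}
    (hw : w ∈ ndw c B v) (hwj : w j ≠ v j) :
    2 ≤ (sl (ndw c B v) j (w j)).card ∧ 2 ≤ (sl (ndw c B v) j (c (w j))).card ∧
    (sl (ndw c B v) j (w j)).card + (ndw c B v).card ≤ A.card ∧
    (sl (ndw c B v) j (c (w j))).card + (ndw c B v).card ≤ A.card := by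
  have h5 := h.five
  have a1 : 1 ≤ (sl (ndw c B v) j (w j)).card := Finset.card_pos.2 ⟨w, mem_sl.2 ⟨hw, rfl⟩⟩
  obtain ⟨y, hy⟩ := h.part.P1 hw rfl hwj
  have a2 : 1 ≤ (sl (ndw c B v) j (c (w j))).card := Finset.card_pos.2 ⟨y, hy⟩
  have b1 := h.sl_le hj hw
  rw [mem_sl] at hy
  have b2 := h.sl_le hj hy.1
  have c1 := h.part.P2 h.nt hw rfl hwj
  have hyj : y j ≠ v j := by
    intro k
    exact h.part.ne_c hw j (by rw [← k, hy.2, cc (c := c)])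
  have c2 := h.part.P2 h.nt hy.1 rfl hyj
  rw [hy.2, cc (c := c)] at c2
  rw [hy.2] at b2
  refine ⟨?_, ?_, b1, b2⟩
  · by_contra hlt
    have := c1 (by omega)
    omega
  · by_contra hlt
    have := c2 (by omega)
    omega

theorem pat (h : Bad c J r A B v) (hm : A.card ≤ 9) {j : Fin d} (hj : j ∈ J) :
    ∃ w ∈ ndw c B v, w j ≠ v j ∧
      (∀ y ∈ ndw c B v, y j = v j ∨ y j = w j ∨ y j = c (w j)) ∧
      (sl (ndw c B v) j (v j)).card + (sl (ndw c B v) j (w j)).card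
        + (sl (ndw c B v) j (c (w j))).card = (ndw c B v).card ∧
      1 ≤ (sl (ndw c B v) j (v j)).card ∧
      (sl (ndw c B v) j (v j)).card + (ndw c B v).card ≤ A.card := by
  have h5 := h.five
  have hex : ∃ w ∈ ndw c B v, w j ≠ v j := by
    by_contra hn
    push Not at hn
    obtain ⟨w, hw⟩ := h.part.nonempty
    have b1 := h.sl_le hj hw
    have : sl (ndw c B v) j (w j) = ndw c B v := by
      ext y
      rw [mem_sl]
      constructor
      · exact fun h => h.1
      · intro hy
        exact ⟨hy, by rw [hn y hy, hn w hw]⟩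
    rw [this] at b1
    omega
  obtain ⟨w, hw, hwj⟩ := hex
  obtain ⟨t1, t2, t3, t4⟩ := h.two_le hm hj hw hwj
  have hwj' : v j ≠ c (w j) := fun k => h.part.ne_c hw j (ceq k)
  have hd1 : Disjoint (sl (ndw c B v) j (w j)) (sl (ndw c B v) j (c (w j))) := by
    rw [Finset.disjoint_left]
    intro y hy hy'
    rw [mem_sl] at hy hy'
    exact cne (c := c) _ (hy'.2.symm.trans hy.2)
  have hall : ∀ y ∈ ndw c B v, y j = v j ∨ y j = w j ∨ y j = c (w j) := by
    intro y hy
    by_contra hn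
    push Not at hn
    obtain ⟨s1, s2, s3, s4⟩ := h.two_le hm hj hy hn.1
    have hd2 : Disjoint (sl (ndw c B v) j (y j)) (sl (ndw c B v) j (c (y j))) := by
      rw [Finset.disjoint_left]
      intro y hy hy'
      rw [mem_sl] at hy hy'
      exact cne (c := c) _ (hy'.2.symm.trans hy.2)
    have hd3 : Disjoint (sl (ndw c B v) j (w j) ∪ sl (ndw c B v) j (c (w j)))
        (sl (ndw c B v) j (y j) ∪ sl (ndw c B v) j (c (y j))) := by
      rw [Finset.disjoint_left]
      intro x hx hx'
      rw [Finset.mem_union, mem_sl, mem_sl] at hx hx'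
      rcases hx with hx | hx <;> rcases hx' with hx' | hx'
      · exact hn.2.1 (hx'.2.symm.trans hx.2)
      · exact hn.2.2 (ceq (hx.2.symm.trans hx'.2))
      · exact hn.2.2 (hx'.2.symm.trans hx.2)
      · exact hn.2.1 (cinj (hx'.2.symm.trans hx.2))
    have hs := Finset.card_le_card (Finset.union_subset
      (Finset.union_subset (sl_sub (ndw c B v) j (w j)) (sl_sub (ndw c B v) j (c (w j))))
      (Finset.union_subset (sl_sub (ndw c B v) j (y j)) (sl_sub (ndw c B v) j (c (y j)))))
    rw [Finset.card_union_of_disjoint hd3, Finset.card_union_of_disjoint hd1,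
      Finset.card_union_of_disjoint hd2] at hs
    omega
  have hd4 : Disjoint (sl (ndw c B v) j (v j))
      (sl (ndw c B v) j (w j) ∪ sl (ndw c B v) j (c (w j))) := by
    rw [Finset.disjoint_left]
    intro x hx hx'
    rw [Finset.mem_union, mem_sl, mem_sl] at hx'
    rw [mem_sl] at hx
    rcases hx' with hx' | hx'
    · exact hwj (hx'.2.symm.trans hx.2)
    · exact hwj' (hx.2.symm.trans hx'.2)
  have hunion : sl (ndw c B v) j (v j) ∪ (sl (ndw c B v) j (w j) ∪ sl (ndw c B v) j (c (w j)))
      = ndw c B v := by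
    ext y
    simp only [Finset.mem_union, mem_sl]
    constructor
    · rintro (h | h | h) <;> exact h.1
    · intro hy
      rcases hall y hy with k | k | k
      · exact Or.inl ⟨hy, k⟩
      · exact Or.inr (Or.inl ⟨hy, k⟩)
      · exact Or.inr (Or.inr ⟨hy, k⟩)
  have hcard := congrArg Finset.card hunion
  rw [Finset.card_union_of_disjoint hd4, Finset.card_union_of_disjoint hd1] at hcard
  have hc0 : 1 ≤ (sl (ndw c B v) j (v j)).card := by
    by_contra hlt
    have he : sl (ndw c B v) j (v j) = ∅ := Finset.card_eq_zero.1 (by omega)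
    rcases h.part.P3 h.nt hw rfl hwj (by
      intro y hy
      rcases hall y hy with k | k | k
      · have : y ∈ sl (ndw c B v) j (v j) := mem_sl.2 ⟨hy, k⟩
        simp [he] at this
      · exact Or.inl k
      · exact Or.inr k) with k | k <;> omega
  refine ⟨w, hw, hwj, hall, by omega, hc0, ?_⟩
  obtain ⟨y, hy⟩ := Finset.card_pos.1 hc0
  rw [mem_sl] at hy
  have := h.sl_le hj hy.1
  rwa [hy.2] at this

/-- agreements inside J -/
def zJ (J : Finset (Fin d)) (v w : Fin d → S) : ℕ := (J.filter (fun i => w i = v i)).card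

theorem zz_eq (h : Bad c J r A B v) {w : Fin d → S} (hw : w ∈ B) :
    zz v w + J.card = zJ J v w + d := by
  have e : zz v w = zJ J v w + (Finset.univ \ J).card := by
    unfold zz zJ
    rw [← Finset.card_union_of_disjoint]
    · congr 1
      ext i
      simp only [Finset.mem_filter, Finset.mem_univ, true_and, Finset.mem_union, Finset.mem_sdiff]
      constructor
      · intro hi
        by_cases hJ : i ∈ J
        · exact Or.inl ⟨hJ, hi⟩
        · exact Or.inr hJ
      · rintro (hi | hi)
        · exact hi.2
        · by_contra hne
          exact hi (h.off hw hne)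
    · rw [Finset.disjoint_left]
      intro i h1 h2
      simp only [Finset.mem_filter, Finset.mem_sdiff] at h1 h2
      exact h2.2 h1.1
  have e2 := Finset.card_sdiff_add_card_eq_card (Finset.subset_univ J)
  rw [Finset.card_univ, Fintype.card_fin] at e2
  omega

theorem vol (h : Bad c J r A B v) : ∑ w ∈ ndw c B v, 2 ^ zJ J v w = 2 ^ J.card := by
  have h1 := h.part.volume
  have h2 : zz v v = d := by simp [zz]
  rw [h2] at h1
  have hd : J.card ≤ d := by
    have := Finset.card_le_univ J
    rwa [Fintype.card_fin] at this
  have h3 : ∑ w ∈ ndw c B v, 2 ^ zz v w = ∑ w ∈ ndw c B v, 2 ^ zJ J v w * 2 ^ (d - J.card) := by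
    apply Finset.sum_congr rfl
    intro w hw
    rw [← pow_add]
    congr 1
    have := h.zz_eq (mem_ndw.1 hw).1
    omega
  rw [h3, ← Finset.sum_mul] at h1
  have h4 : 2 ^ d = 2 ^ J.card * 2 ^ (d - J.card) := by
    rw [← pow_add]
    congr 1
    omega
  rw [h4] at h1
  exact Nat.eq_of_mul_eq_mul_right (by positivity) h1

theorem sum_zJ (C : Finset (Fin d → S)) (J : Finset (Fin d)) (v : Fin d → S) :
    ∑ w ∈ C, zJ J v w = ∑ j ∈ J, (sl C j (v j)).card := by
  unfold zJ sl
  simp only [Finset.card_filter]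
  rw [Finset.sum_comm]

theorem diff_card (h : Bad c J r A B v) {w : Fin d → S} (hw : w ∈ B) :
    (Finset.univ.filter (fun i => w i ≠ v i)).card + zJ J v w = J.card := by
  have e : Finset.univ.filter (fun i => w i ≠ v i) = J.filter (fun i => ¬ w i = v i) := by
    ext i
    simp only [Finset.mem_filter, Finset.mem_univ, true_and]
    exact ⟨fun hi => ⟨h.off hw hi, hi⟩, fun hi => hi.2⟩
  rw [e, zJ, add_comm]
  exact Finset.card_filter_add_card_filter_not _

theorem case5_4 (h : Bad c J r A B v) (hm : A.card ≤ 9) (hJ : J.card = 4)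
    (hn : (ndw c B v).card = 5) : False := by
  have h1 := sum_zJ (ndw c B v) J v
  have h2 : ∀ j ∈ J, (sl (ndw c B v) j (v j)).card ≤ 1 := by
    intro j hj
    obtain ⟨w, hw, k1, _, k3, _, _⟩ := h.pat hm hj
    have := h.two_le hm hj hw k1
    omega
  have h3 := Finset.sum_le_card_nsmul J _ 1 h2
  rw [hJ] at h3
  have h4 := h.vol
  rw [hJ] at h4
  have h5 : ∀ w ∈ ndw c B v, 3 * 2 ^ zJ J v w ≤ 3 + 7 * zJ J v w := by
    intro w hw
    have e1 := h.diff_card (mem_ndw.1 hw).1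
    have e2 := h.part.card_sub hw
    have : zJ J v w ≤ 3 := by
      by_contra hlt
      have : (Finset.univ.filter (fun i => w i ≠ v i)).card = 0 := by omega
      rw [Finset.card_eq_zero] at this
      rw [this, Finset.sum_empty] at e2
      omega
    interval_cases zJ J v w <;> omega
  have h6 := Finset.sum_le_sum h5
  rw [← Finset.mul_sum, Finset.sum_add_distrib, ← Finset.mul_sum, h4, Finset.sum_const, hn] at h6
  simp only [smul_eq_mul] at h6 h3
  omega

theorem case6_4 (h : Bad c J r A B v) (hm : A.card ≤ 9) (hJ : J.card = 4)
    (hn : (ndw c B v).card = 6) : False := by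
  classical
  let g : (Fin d → S) → Fin d → ℕ := fun w j => if w j = v j then 2 else
    if (sl (ndw c B v) j (c (w j))).card = 3 then 1 else 0
  have h1 : ∑ w ∈ ndw c B v, ∑ j ∈ J, g w j ≤ 16 := by
    rw [Finset.sum_comm]
    have : ∀ j ∈ J, ∑ w ∈ ndw c B v, g w j ≤ 4 := by
      intro j hj
      obtain ⟨w, hw, k1, k2, k3, k4, k5⟩ := h.pat hm hj
      obtain ⟨t1, t2, t3, t4⟩ := h.two_le hm hj hw k1
      have hb : ∑ y ∈ ndw c B v, g y j ≤ ∑ y ∈ ndw c B v,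
          ((if y j = v j then 2 else 0)
          + (if y j = w j then (if (sl (ndw c B v) j (c (w j))).card = 3 then 1 else 0) else 0)
          + (if y j = c (w j) then (if (sl (ndw c B v) j (w j)).card = 3 then 1 else 0) else 0)) := by
        apply Finset.sum_le_sum
        intro y hy
        simp only [g]
        rcases k2 y hy with e | e | e
        · simp only [if_pos e]; omega
        · rw [if_neg (by rw [e]; exact k1), if_pos e, e]; omega
        · rw [if_neg (by rw [e]; intro k; exact h.part.ne_c hw j (by rw [← k, cc (c := c)])),
            if_pos e, e, cc (c := c)]
          omega
      have e1 : ∀ (s : S) (k : ℕ), ∑ y ∈ ndw c B v, (if y j = s then k else 0)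
          = (sl (ndw c B v) j s).card * k := by
        intro s k
        rw [← Finset.sum_filter, Finset.sum_const, smul_eq_mul, sl]
      rw [Finset.sum_add_distrib, Finset.sum_add_distrib, e1, e1, e1] at hb
      refine hb.trans ?_
      split_ifs <;> omega
    have := Finset.sum_le_card_nsmul J _ 4 this
    rw [hJ] at this
    simpa using this
  have h2 : ∀ w ∈ ndw c B v, 5 * 2 ^ zJ J v w ≤ 3 * (∑ j ∈ J, g w j) + 5 := by
    intro w hw
    have e1 := h.diff_card (mem_ndw.1 hw).1
    have e2 := h.part.card_sub hw
    have f1 : 2 * zJ J v w ≤ ∑ j ∈ J, g w j := by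
      unfold zJ
      rw [Finset.card_filter, Finset.mul_sum]
      apply Finset.sum_le_sum
      intro j hj
      simp only [g]
      split_ifs <;> omega
    have f2 : ∀ i ∈ Finset.univ.filter (fun i => w i ≠ v i), (sl (ndw c B v) i (c (w i))).card ≤ 3 := by
      intro i hi
      have hi := (Finset.mem_filter.1 hi).2
      have := h.two_le hm (h.off (mem_ndw.1 hw).1 hi) hw hi
      omega
    have f3 := Finset.sum_le_card_nsmul _ _ 3 f2
    rw [smul_eq_mul] at f3
    have : zJ J v w ≤ 2 := by omega
    rcases Nat.lt_or_ge (zJ J v w) 2 with hz | hz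
    · have : zJ J v w = 0 ∨ zJ J v w = 1 := by omega
      rcases this with e | e <;> rw [e] at f1 ⊢ <;> omega
    · have hz2 : zJ J v w = 2 := by omega
      have : 2 * zJ J v w < ∑ j ∈ J, g w j := by
        have hex : ∃ i ∈ Finset.univ.filter (fun i => w i ≠ v i),
            (sl (ndw c B v) i (c (w i))).card = 3 := by
          by_contra hno
          push Not at hno
          have f4 := Finset.sum_le_card_nsmul (Finset.univ.filter (fun i => w i ≠ v i))
            (fun i => (sl (ndw c B v) i (c (w i))).card) 2 (by
            intro i hi
            have h1 := f2 i hi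
            have h2 := hno i hi
            show (sl (ndw c B v) i (c (w i))).card ≤ 2
            omega)
          rw [smul_eq_mul] at f4
          omega
        obtain ⟨i, hi, hi3⟩ := hex
        have hi := (Finset.mem_filter.1 hi).2
        unfold zJ
        rw [Finset.card_filter, Finset.mul_sum]
        apply Finset.sum_lt_sum
        · intro j hj
          simp only [g]
          split_ifs <;> omega
        · refine ⟨i, h.off (mem_ndw.1 hw).1 hi, ?_⟩
          simp only [g]
          rw [if_neg hi, if_neg hi, if_pos hi3]
          omega
      rw [hz2] at this ⊢
      omega
  have h3 := Finset.sum_le_sum h2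
  rw [← Finset.mul_sum, Finset.sum_add_distrib, ← Finset.mul_sum, h.vol, hJ, Finset.sum_const, hn] at h3
  simp only [smul_eq_mul] at h3
  omega

theorem case5_3 (h : Bad c J r A B v) (hm : A.card ≤ 7) (hJ : J.card = 3)
    (hn : (ndw c B v).card = 5) : False := by
  have h1 := sum_zJ (ndw c B v) J v
  have h2 : ∀ j ∈ J, (sl (ndw c B v) j (v j)).card ≤ 1 := by
    intro j hj
    obtain ⟨w, hw, k1, _, k3, _, _⟩ := h.pat (by omega) hj
    have := h.two_le (by omega) hj hw k1
    omega
  have h3 := Finset.sum_le_card_nsmul J _ 1 h2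
  rw [hJ] at h3
  have h0 : ∃ w ∈ ndw c B v, zJ J v w = 0 := by
    by_contra hno
    push Not at hno
    have := Finset.card_nsmul_le_sum (ndw c B v) (fun w => zJ J v w) 1 (by
      intro w hw
      exact Nat.one_le_iff_ne_zero.2 (hno w hw))
    rw [hn] at this
    simp only [smul_eq_mul] at this h3
    omega
  obtain ⟨w, hw, hz⟩ := h0
  have hzj : ∀ j ∈ J, w j ≠ v j := by
    intro j hj k
    have : j ∈ J.filter (fun i => w i = v i) := Finset.mem_filter.2 ⟨hj, k⟩
    rw [zJ, Finset.card_eq_zero] at hz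
    simp [hz] at this
  have hj0 : ∃ j, j ∈ J := by
    apply Finset.card_pos.1
    omega
  obtain ⟨j0, hj0⟩ := hj0
  have t0 := h.two_le (by omega) hj0 hw (hzj j0 hj0)
  have hAB := card_eq_of_Eqv h.codeA h.codeB h.eqv
  obtain ⟨y, hyB, hyC⟩ := Finset.exists_mem_notMem_of_card_lt_card
    (show (ndw c B v).card < B.card by omega)
  have hyw : y ≠ w := fun k => hyC (k ▸ hw)
  obtain ⟨j, hj⟩ := h.codeB y hyB w (mem_ndw.1 hw).1 hyw
  have hjJ : j ∈ J := by
    by_contra hn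
    rw [h.coB y hyB j hn, h.coB w (mem_ndw.1 hw).1 j hn] at hj
    exact cne (c := c) _ hj.symm
  have t := h.two_le (by omega) hjJ hw (hzj j hjJ)
  have sb := h.slb j hjJ y hyB
  rw [hj] at sb
  have : insert y (sl (ndw c B v) j (c (w j))) ⊆ sl B j (c (w j)) := by
    intro x hx
    rw [Finset.mem_insert] at hx
    rcases hx with rfl | hx
    · exact mem_sl.2 ⟨hyB, hj⟩
    · rw [mem_sl] at hx ⊢
      exact ⟨(mem_ndw.1 hx.1).1, hx.2⟩
  have := Finset.card_le_card this
  rw [Finset.card_insert_of_notMem (fun k => hyC (mem_sl.1 k).1)] at this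
  omega

theorem n_le (h : Bad c J r A B v) (hm : A.card ≤ 9) (hJ : J.Nonempty) :
    (ndw c B v).card ≤ 6 ∧ (ndw c B v).card + 2 ≤ A.card := by
  obtain ⟨j, hj⟩ := hJ
  obtain ⟨w, hw, k1, _, k3, _, _⟩ := h.pat hm hj
  have := h.two_le hm hj hw k1
  omega

end Bad

theorem LL2 (k : ℕ) (hk : k ≤ 2) : ∀ J : Finset (Fin d), J.card = k → ∀ M, LL c J M := by
  induction k with
  | zero =>
    intro J hJ M
    apply LL_of
    · intro j hj
      rw [Finset.card_eq_zero] at hJ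
      simp [hJ] at hj
    · intro r A B v h _
      have h1 := h.five
      have h2 := h.le_pow
      rw [hJ] at h2
      omega
  | succ k ih =>
    intro J hJ M
    apply LL_of
    · intro j hj M
      exact ih (by omega) _ (by rw [Finset.card_erase_of_mem hj]; omega) M
    · intro r A B v h _
      have h1 := h.five
      have h2 := h.le_pow
      have h3 : 2 ^ J.card ≤ 2 ^ 2 := Nat.pow_le_pow_right (by norm_num) (by omega)
      omega

theorem LL3a (J : Finset (Fin d)) (hJ : J.card = 3) : LL c J 7 := by
  apply LL_of
  · intro j hj M
    exact LL2 2 le_rfl _ (by rw [Finset.card_erase_of_mem hj]; omega) M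
  · intro r A B v h hm
    have h1 := h.five
    have h2 := h.n_le (by omega) (Finset.card_pos.1 (by omega))
    exact h.case5_3 hm hJ (by omega)

theorem LL3 (J : Finset (Fin d)) (hJ : J.card = 3) (M : ℕ) : LL c J M := by
  intro r A B hr hA hB hE hM
  have hA8 := card_le_of_CO hA hr
  rw [hJ] at hA8
  rcases Nat.lt_or_ge A.card 8 with hlt | hge
  · exact LL3a J hJ r A B hr hA hB hE (by omega)
  · have key : ∀ X, IsCode c X → CO r J X → X.card = 8 → GC c (UJ c r J) X := by
      intro X hX hXr hX8
      by_contra hn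
      obtain ⟨B2, v, h1, h2, h3, h4, h5, h6, h7⟩ := min_lemma
        (fun j hj M => LL2 2 le_rfl _ (by rw [Finset.card_erase_of_mem hj]; omega) M)
        (fun A' B' a1 a2 a3 a4 a5 => LL3a J hJ r A' B' a1 a2 a3 a4 (by
          rw [card_UJ, hJ] at a5; omega))
        (code_UJ r J) hX (CO_UJ r J) (Eqv_UJ hX hXr (by rw [hX8, hJ]; norm_num)).symm hn
      obtain ⟨w, hw⟩ := nonempty_of_Eqv h2 ⟨v, h3⟩
      apply Finset.disjoint_left.1 h4 _ hw
      rw [mem_UJ]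
      intro i
      refine ⟨fun hi => ?_, fun hi => CO_of_Eqv (CO_UJ r J) h2 w hw i hi⟩
      obtain ⟨u, hu, hui⟩ := h5 i hi w hw
      have := ceq hui
      rcases (mem_UJ.1 hu i).1 hi with k | k
      · right; rw [this, k]
      · left; rw [this, k, cc (c := c)]
    have hAB := card_eq_of_Eqv hA hB hE
    exact ((key A hA hr (by omega)).symm (code_UJ r J)).trans
      (key B hB (CO_of_Eqv hr hE) (by omega))

theorem LL4 (J : Finset (Fin d)) (hJ : J.card = 4) : LL c J 9 := by
  apply LL_of
  · intro j hj M
    exact LL3 _ (by rw [Finset.card_erase_of_mem hj]; omega) M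
  · intro r A B v h hm
    have h1 := h.five
    have h2 := h.n_le hm (Finset.card_pos.1 (by omega))
    rcases (show (ndw c B v).card = 5 ∨ (ndw c B v).card = 6 by omega) with e | e
    · exact h.case5_4 hm hJ e
    · exact h.case6_4 hm hJ e

theorem sum_zz (C : Finset (Fin d → S)) (v : Fin d → S) :
    ∑ w ∈ C, zz v w = ∑ j, (sl C j (v j)).card := by
  unfold zz sl
  simp only [Finset.card_filter]
  rw [Finset.sum_comm]

theorem zz_diff (v w : Fin d → S) :
    (Finset.univ.filter (fun i => w i ≠ v i)).card + zz v w = d := by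
  have := Finset.card_filter_add_card_filter_not (s := (Finset.univ : Finset (Fin d)))
    (fun i => w i = v i)
  rw [Finset.card_univ, Fintype.card_fin] at this
  rw [zz, add_comm]
  exact this

/-- the key count for relative partitions in dimension five -/
theorem RP {u : Fin 5 → S} {C : Finset (Fin 5 → S)} (h : Part c u u C) (ht : ¬ HasTwin c C)
    {j0 : Fin 5} (hj0 : ∀ w ∈ C, w j0 = u j0)
    (huniq : ∀ k, ∀ w ∈ C, ∀ w' ∈ C, w k ≠ u k → w' k ≠ u k → w' k = w k ∨ w' k = c (w k))
    (h5 : 5 ≤ C.card) (h11 : C.card ≤ 11) :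
    C.card + 18 ≤ 2 * ∑ w ∈ C, zz u w ∧ 12 ≤ ∑ w ∈ C, zz u w := by
  have hvol := h.volume
  rw [show zz u u = 5 by simp [zz]] at hvol
  have hz1 : ∀ w ∈ C, 1 ≤ zz u w := by
    intro w hw
    apply Finset.card_pos.2
    exact ⟨j0, by simp [hj0 w hw]⟩
  have hz4 : ∀ w ∈ C, zz u w ≤ 4 := by
    intro w hw
    by_contra hlt
    have e1 := zz_diff u w
    have e2 := h.card_sub hw
    have : (Finset.univ.filter (fun i => w i ≠ u i)).card = 0 := by omega
    rw [Finset.card_eq_zero] at this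
    rw [this, Finset.sum_empty] at e2
    omega
  by_cases hex : ∃ w ∈ C, zz u w = 4
  · obtain ⟨w, hw, hwz⟩ := hex
    have e1 := zz_diff u w
    obtain ⟨i, hi⟩ := Finset.card_eq_one.1
      (show (Finset.univ.filter (fun i => w i ≠ u i)).card = 1 by omega)
    have hwi : ∀ k, w k ≠ u k ↔ k = i := by
      intro k
      have : k ∈ Finset.univ.filter (fun i => w i ≠ u i) ↔ k ∈ ({i} : Finset (Fin 5)) := by rw [hi]
      simpa using this
    have hwi0 : w i ≠ u i := (hwi i).2 rfl
    have hwk : ∀ k, k ≠ i → w k = u k := by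
      intro k hk
      by_contra hne
      exact hk ((hwi k).1 hne)
    have hrest : ∀ y ∈ C, y ≠ w → y i = c (w i) := by
      intro y hy hne
      obtain ⟨k, hk⟩ := h.code y hy w hw hne
      by_cases hki : k = i
      · rw [← hki, hk]
      · rw [hwk k hki] at hk
        exact absurd hk (h.ne_c hy k)
    have hsl : sl C i (w i) = {w} := by
      ext y
      rw [mem_sl, Finset.mem_singleton]
      constructor
      · rintro ⟨h1, h2⟩
        by_contra hne
        rw [hrest y h1 hne] at h2
        exact cne (c := c) _ h2
      · rintro rfl
        exact ⟨hw, rfl⟩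
    have hvi : u i ≠ c (w i) := fun k => h.ne_c hw i (ceq k)
    have hP := h.S2 rfl hwi0.symm hvi hsl
    have hDe : sl C i (c (w i)) = C.erase w := by
      ext y
      rw [mem_sl, Finset.mem_erase]
      constructor
      · rintro ⟨h1, h2⟩
        refine ⟨?_, h1⟩
        rintro rfl
        exact cne (c := c) _ h2.symm
      · rintro ⟨h1, h2⟩
        exact ⟨h2, hrest y h2 h1⟩
    have hD5 := h.P2 ht hw rfl hwi0 (by rw [hsl, Finset.card_singleton])
    set D := sl C i (c (w i)) with hD
    set x := Function.update w i (c (w i)) with hx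
    have hDC : D ⊆ C := sl_sub _ _ _
    have hDi : ∀ y ∈ D, y i = c (w i) := fun y hy => (mem_sl.1 hy).2
    have hDt : ¬ HasTwin c D := fun k => ht (k.mono hDC)
    have hDcard : C.card = D.card + 1 := by
      rw [hDe, Finset.card_erase_add_one hw]
    have hDv : ∑ y ∈ D, 2 ^ zz u y = 16 := by
      have := Finset.add_sum_erase C (fun y => 2 ^ zz u y) hw
      simp only [hwz] at this
      rw [hvol, ← hDe] at this
      omega
    have hDz : ∑ y ∈ C, zz u y = 4 + ∑ y ∈ D, zz u y := by
      have := Finset.add_sum_erase C (fun y => zz u y) hw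
      simp only [hwz] at this
      rw [← hDe] at this
      omega
    have hpow : ∀ y ∈ D, 2 ≤ 2 ^ zz u y := by
      intro y hy
      calc 2 = 2 ^ 1 := rfl
        _ ≤ 2 ^ zz u y := Nat.pow_le_pow_right (by norm_num) (hz1 y (hDC hy))
    have hD8 : D.card ≤ 8 := by
      have := Finset.card_nsmul_le_sum D (fun y => 2 ^ zz u y) 2 hpow
      rw [hDv, smul_eq_mul] at this
      omega
    have hxk : ∀ k, k ≠ i → x k = u k := by
      intro k hk
      rw [hx, Function.update_of_ne hk, hwk k hk]
    have hz2 : ∀ y ∈ D, zz u y ≤ 2 := by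
      intro y hy
      have hE := Finset.add_sum_erase D (fun y => 2 ^ zz u y) hy
      rw [hDv] at hE
      have hEc := Finset.card_erase_add_one hy
      have hE2 := Finset.card_nsmul_le_sum (D.erase y) (fun y => 2 ^ zz u y) 2
        (fun z hz => hpow z (Finset.mem_of_mem_erase hz))
      rw [smul_eq_mul] at hE2
      by_contra hlt
      have hy4 := hz4 y (hDC hy)
      rcases (show zz u y = 3 ∨ zz u y = 4 by omega) with e | e
      · simp only [e] at hE
        have e3 := zz_diff u y
        have hyi : y i ≠ u i := by
          rw [hDi y hy]; exact hvi.symm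
        obtain ⟨k, hk⟩ := Finset.card_eq_one.1
          (show ((Finset.univ.filter (fun m => y m ≠ u m)).erase i).card = 1 by
            rw [Finset.card_erase_of_mem (by simp [hyi])]; omega)
        have hkm : ∀ m, (m ≠ i ∧ y m ≠ u m) ↔ m = k := by
          intro m
          have : m ∈ (Finset.univ.filter (fun m => y m ≠ u m)).erase i ↔
            m ∈ ({k} : Finset (Fin 5)) := by rw [hk]
          simpa using this
        have hk0 := (hkm k).2 rfl
        have hEk : ∀ z ∈ D, z ≠ y → z k = c (y k) := by
          intro z hz hne
          obtain ⟨m, hm⟩ := h.code z (hDC hz) y (hDC hy) hne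
          by_cases hmi : m = i
          · rw [hmi, hDi z hz, hDi y hy] at hm
            exact absurd hm.symm (cne (c := c) _)
          · by_cases hmu : y m = u m
            · rw [hmu] at hm
              exact absurd hm (h.ne_c (hDC hz) m)
            · rw [← (hkm m).1 ⟨hmi, hmu⟩, hm]
        have hone : (sl D k (y k)).card = 1 := by
          rw [Finset.card_eq_one]
          refine ⟨y, ?_⟩
          ext z
          rw [mem_sl, Finset.mem_singleton]
          constructor
          · rintro ⟨h1, h2⟩
            by_contra hne
            rw [hEk z h1 hne] at h2
            exact cne (c := c) _ h2
          · rintro rfl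
            exact ⟨hy, rfl⟩
        have h6 := hP.P2 hDt hy (hxk k hk0.1) hk0.2 hone
        have h7 : sl D k (c (y k)) ⊆ D.erase y := by
          intro z hz
          rw [mem_sl] at hz
          rw [Finset.mem_erase]
          refine ⟨?_, hz.1⟩
          rintro rfl
          exact cne (c := c) _ hz.2.symm
        have := Finset.card_le_card h7
        omega
      · simp only [e] at hE
        omega
    have hDs : ∑ y ∈ D, zz u y = 8 := by
      have : ∑ y ∈ D, 2 ^ zz u y = ∑ y ∈ D, 2 * zz u y := by
        apply Finset.sum_congr rfl
        intro y hy
        have k1 := hz1 y (hDC hy)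
        have k2 := hz2 y hy
        rcases (show zz u y = 1 ∨ zz u y = 2 by omega) with e | e <;> rw [e] <;> rfl
      rw [hDv, ← Finset.mul_sum] at this
      omega
    have hpos : ∀ k, k ≠ i → 1 ≤ (sl D k (u k)).card := by
      intro k hki
      by_contra hlt
      have hno : ∀ y ∈ D, y k ≠ u k := by
        intro y hy e
        apply hlt
        exact Finset.card_pos.2 ⟨y, mem_sl.2 ⟨hy, e⟩⟩
      have hsing : ∀ y ∈ D, (sl D k (y k)).card ≠ 1 := by
        intro y hy e
        obtain ⟨y', hy'⟩ := Finset.card_eq_one.1 e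
        have hyC : ∀ z ∈ D, z k = y k ∨ z k = c (y k) := fun z hz =>
          huniq k y (hDC hy) z (hDC hz) (hno y hy) (hno z hz)
        have hPP := hP.S3 (hxk k hki) (hno y hy).symm (fun e => h.ne_c (hDC hy) k (ceq e)) hyC
        have hsg := hPP.single hy'
        have hy'D : y' ∈ D := by
          have : y' ∈ sl D k (y k) := by simp [hy']
          exact (mem_sl.1 this).1
        have hzz := hz2 y' hy'D
        have : (Finset.univ.erase i).erase k ⊆ Finset.univ.filter (fun m => y' m = u m) := by
          intro m hm
          simp only [Finset.mem_erase, Finset.mem_univ, and_true] at hm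
          simp only [Finset.mem_filter, Finset.mem_univ, true_and]
          rw [hsg, Function.update_of_ne hm.1, hxk m hm.2]
        have := Finset.card_le_card this
        rw [Finset.card_erase_of_mem (by simp [hki]), Finset.card_erase_of_mem (by simp),
          Finset.card_univ, Fintype.card_fin] at this
        unfold zz at hzz
        omega
      obtain ⟨y, hy⟩ := hP.nonempty
      obtain ⟨y2, hy2⟩ := hP.P1 hy (hxk k hki) (hno y hy)
      rw [mem_sl] at hy2
      have q1 := hP.P3 hDt hy (hxk k hki) (hno y hy) (fun z hz =>
          huniq k y (hDC hy) z (hDC hz) (hno y hy) (hno z hz))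
      have q2 := hP.P3 hDt hy2.1 (hxk k hki) (hno y2 hy2.1) (fun z hz =>
          huniq k y2 (hDC hy2.1) z (hDC hz) (hno y2 hy2.1) (hno z hz))
      have r1 := hsing y hy
      have r2 := hsing y2 hy2.1
      have hd : Disjoint (sl D k (y k)) (sl D k (y2 k)) := by
        rw [Finset.disjoint_left]
        intro z h1 h2
        rw [mem_sl] at h1 h2
        have := h1.2.symm.trans h2.2
        rw [hy2.2] at this
        exact cne (c := c) _ this.symm
      have := Finset.card_le_card (Finset.union_subset (sl_sub D k (y k)) (sl_sub D k (y2 k)))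
      rw [Finset.card_union_of_disjoint hd] at this
      omega
    have hij : j0 ≠ i := by
      rintro rfl
      exact hwi0 (hj0 w hw)
    have hS := sum_zz D u
    rw [hDs, ← Finset.add_sum_erase _ _ (Finset.mem_univ j0),
      ← Finset.add_sum_erase _ _ (show i ∈ Finset.univ.erase j0 by simp [hij.symm])] at hS
    have hS2 := Finset.card_nsmul_le_sum ((Finset.univ.erase j0).erase i)
      (fun k => (sl D k (u k)).card) 1 (by
        intro k hk
        simp only [Finset.mem_erase] at hk
        exact hpos k hk.1)
    rw [Finset.card_erase_of_mem (by simp [hij.symm]), Finset.card_erase_of_mem (by simp),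
          Finset.card_univ, Fintype.card_fin, smul_eq_mul] at hS2
    have hSj : sl D j0 (u j0) = D := by
      ext y
      rw [mem_sl]
      exact ⟨fun h => h.1, fun hy => ⟨hy, hj0 y (hDC hy)⟩⟩
    rw [hSj] at hS
    omega
  · push Not at hex
    have hz3 : ∀ w ∈ C, zz u w = 1 ∨ zz u w = 2 ∨ zz u w = 3 := by
      intro w hw
      have := hz1 w hw
      have := hz4 w hw
      have := hex w hw
      omega
    have a1 : ∑ w ∈ C, 3 * 2 ^ zz u w ≤ ∑ w ∈ C, 8 * zz u w := by
      apply Finset.sum_le_sum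
      intro w hw
      rcases hz3 w hw with e | e | e <;> rw [e] <;> norm_num
    have a2 : ∑ w ∈ C, (2 * 2 ^ zz u w + 2) ≤ ∑ w ∈ C, 6 * zz u w := by
      apply Finset.sum_le_sum
      intro w hw
      rcases hz3 w hw with e | e | e <;> rw [e] <;> norm_num
    rw [← Finset.mul_sum, ← Finset.mul_sum, hvol] at a1
    rw [Finset.sum_add_distrib, ← Finset.mul_sum, ← Finset.mul_sum, hvol, Finset.sum_const,
      smul_eq_mul] at a2
    omega

theorem sl_eqv_of {A B : Finset (Fin d → S)} (hE : ∀ p : Fin d → Pt c, Cov p A → Cov p B)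
    {j : Fin d} {t : S} (hB : ∀ w ∈ B, w j = t ∨ w j = c t) (p : Fin d → Pt c)
    (h : Cov p (sl A j t)) : Cov p (sl B j t) := by
  obtain ⟨w, hw, hp⟩ := h
  obtain ⟨hw1, hw2⟩ := mem_sl.1 hw
  obtain ⟨u, hu, hpu⟩ := hE p ⟨w, hw1, hp⟩
  rcases hB u hu with h1 | h1
  · exact ⟨u, mem_sl.2 ⟨hu, h1⟩, hpu⟩
  · have a := InB_jc hpu h1
    have b := hp j
    rw [hw2, a] at b
    simp at b

theorem sl_union {A : Finset (Fin d → S)} {j : Fin d} {t : S}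
    (hA : ∀ w ∈ A, w j = t ∨ w j = c t) : sl A j t ∪ sl A j (c t) = A := by
  ext w
  simp only [Finset.mem_union, mem_sl]
  constructor
  · rintro (h | h) <;> exact h.1
  · intro h
    rcases hA w h with h1 | h1
    · exact Or.inl ⟨h, h1⟩
    · exact Or.inr ⟨h, h1⟩

theorem sl_disj {A B : Finset (Fin d → S)} {j : Fin d} {t : S} :
    Disjoint (sl A j t) (sl B j (c t)) := by
  rw [Finset.disjoint_left]
  intro w h1 h2
  have a := (mem_sl.1 h1).2
  have b := (mem_sl.1 h2).2
  exact cne (c := c) t (b.symm.trans a)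

/-- product lemma -/
theorem prod_GC {r : Fin d → S} {J : Finset (Fin d)} {A B : Finset (Fin d → S)}
    (hr : CO r J A) (hA : IsCode c A) (hB : IsCode c B) (hE : Eqv c A B) (hJ : J.card = 4)
    {j : Fin d} (hj : j ∈ J) {t : S} (hAt : ∀ w ∈ A, w j = t ∨ w j = c t)
    (hBt : ∀ w ∈ B, w j = t ∨ w j = c t) : GC c A B := by
  have sw : ∀ X : Finset (Fin d → S), (∀ w ∈ X, w j = t ∨ w j = c t) →
      ∀ w ∈ X, w j = c t ∨ w j = c (c t) := by
    intro X hX w hw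
    rw [cc (c := c)]
    exact (hX w hw).symm
  have h3 : (J.erase j).card = 3 := by rw [Finset.card_erase_of_mem hj]; omega
  have g1 : GC c (sl A j t) (sl B j t) := by
    refine LL3 (J.erase j) h3 (sl A j t).card _ _ _ (CO_sl hr j t) (hA.mono (sl_sub _ _ _))
      (hB.mono (sl_sub _ _ _)) ?_ le_rfl
    intro p
    exact ⟨sl_eqv_of (fun p => (hE p).1) hBt p, sl_eqv_of (fun p => (hE p).2) hAt p⟩
  have g2 : GC c (sl A j (c t)) (sl B j (c t)) := by
    refine LL3 (J.erase j) h3 (sl A j (c t)).card _ _ _ (CO_sl hr j (c t))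
      (hA.mono (sl_sub _ _ _)) (hB.mono (sl_sub _ _ _)) ?_ le_rfl
    intro p
    exact ⟨sl_eqv_of (fun p => (hE p).1) (sw _ hBt) p, sl_eqv_of (fun p => (hE p).2) (sw _ hAt) p⟩
  have hA' := hA
  rw [← sl_union hAt] at hA'
  have s1 := (lift_GC g1 hA' sl_disj).gc
  have hc1 := s1.code hA'
  rw [Finset.union_comm] at hc1
  have s2 := (lift_GC g2 hc1 sl_disj.symm).gc
  rw [Finset.union_comm, Finset.union_comm (sl B j (c t))] at s2
  have := s1.trans s2
  rwa [sl_union hAt, sl_union hBt] at this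

/-- native letters -/
def NF (c : S → S) (s : Fin d → S) (i : Fin d) (x : S) : Prop := x = s i ∨ x = c (s i)

instance (s : Fin d → S) (i : Fin d) (x : S) : Decidable (NF c s i x) := by
  unfold NF; infer_instance

/-- number of foreign letters -/
def phi (c : S → S) (s : Fin d → S) (i : Fin d) (x : S) : ℕ := if NF c s i x then 0 else 1

theorem NF_c {s : Fin d → S} {i : Fin d} {x : S} : NF c s i (c x) ↔ NF c s i x := by
  unfold NF
  constructor
  · rintro (h | h)
    · exact Or.inr (ceq h.symm)
    · exact Or.inl (cinj h)
  · rintro (h | h)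
    · exact Or.inr (by rw [h])
    · exact Or.inl (by rw [h, cc (c := c)])

theorem phi_c (s : Fin d → S) (i : Fin d) (x : S) : phi c s i (c x) = phi c s i x := by
  unfold phi
  by_cases h : NF c s i x
  · rw [if_pos h, if_pos (NF_c.2 h)]
  · rw [if_neg h, if_neg (fun h' => h (NF_c.1 h'))]

theorem phi_pos {s : Fin d → S} {i : Fin d} {x : S} (h : ¬ NF c s i x) : 0 < phi c s i x := by
  simp [phi, h]

theorem phi_s (s : Fin d → S) (i : Fin d) : phi c s i (s i) = 0 := by
  simp [phi, NF]

/-- minimal counterexample -/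
structure MinT (c : S → S) (s : Fin 5 → S) (Q V : Finset (Fin 5 → S)) : Prop where
  code : IsCode c V
  card : V.card = 32
  sub : Q ⊆ V
  nat : ∀ w ∈ Q, ∀ i, NF c s i (w i)
  min : ∀ V', GCFix c Q V V' → Psi (phi c s) V ≤ Psi (phi c s) V'

theorem MinT.eqv {s : Fin 5 → S} {Q V : Finset (Fin 5 → S)} (h : MinT c s Q V) (r : Fin 5 → S) :
    Eqv c V (UJ c r Finset.univ) :=
  Eqv_UJ h.code (fun w _ i hi => absurd (Finset.mem_univ i) hi) (by rw [h.card]; rfl)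

theorem MinT.cov {s : Fin 5 → S} {Q V : Finset (Fin 5 → S)} (h : MinT c s Q V)
    (r : Fin 5 → S) (p : Fin 5 → Pt c) (hp : InB p r) : Cov p V := by
  rw [h.eqv r p]
  exact ⟨r, mem_UJ.2 (fun i => ⟨fun _ => Or.inl rfl, fun _ => rfl⟩), hp⟩

theorem MinT.twin {s : Fin 5 → S} {Q V : Finset (Fin 5 → S)} (h : MinT c s Q V)
    {w : Fin 5 → S} {j : Fin 5} (hw : w ∈ V) (hw' : Function.update w j (c (w j)) ∈ V) :
    NF c s j (w j) := by
  by_contra hn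
  have h1 := F0 (c := c) (φ := phi c s) (phi_c s) hw hw' (phi_pos hn) (phi_s s j)
  have h2 := h.min _ (Relation.ReflTransGen.single ⟨step_mk hw hw' (s j), ?_⟩)
  · omega
  · intro u hu
    refine Finset.mem_union_left _ (Finset.mem_sdiff.2 ⟨h.sub hu, ?_⟩)
    rw [Finset.mem_insert, Finset.mem_singleton]
    have hN := h.nat u hu j
    rintro (rfl | rfl)
    · exact hn hN
    · rw [Function.update_self, NF_c] at hN
      exact hn hN

theorem MinT.UN {s : Fin 5 → S} {u : Fin 5 → S} (hu : u ∈ UJ c s Finset.univ) (j : Fin 5) :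
    NF c s j (u j) := ((mem_UJ.1 hu) j).1 (Finset.mem_univ j)

theorem MinT.slices {s : Fin 5 → S} {Q V : Finset (Fin 5 → S)} (h : MinT c s Q V)
    {j : Fin 5} {σ : S} (hn : ¬ NF c s j σ) :
    Eqv c (sl V j σ) (sh (sl V j (c σ)) j σ) := by
  refine slice_eqv (code_UJ s Finset.univ) h.code (Eqv.symm (h.eqv s)) ?_ ?_
  · rintro u hu rfl
    exact hn (MinT.UN hu j)
  · intro u hu e
    have := MinT.UN hu j
    rw [e, NF_c] at this
    exact hn this

theorem MinT.notboth {s : Fin 5 → S} {Q V : Finset (Fin 5 → S)} (h : MinT c s Q V)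
    {j : Fin 5} {σ : S} (hn : ¬ NF c s j σ) (hne : (sl V j σ).Nonempty)
    (g1 : GC c (sl V j σ) (sh (sl V j (c σ)) j σ))
    (g2 : GC c (sl V j (c σ)) (sh (sl V j σ) j (c σ))) : False := by
  obtain ⟨V', hf, hlt⟩ := F2 (code_UJ s Finset.univ) h.code (Eqv.symm (h.eqv s)) (j := j) (σ := σ)
    (τ := s j) (φ := phi c s) (by
      rintro u hu rfl
      exact hn (MinT.UN hu j)) (by
      intro u hu e
      have := MinT.UN hu j
      rw [e, NF_c] at this
      exact hn this) (phi_c s) (phi_pos hn) (phi_s s j) hne g1 g2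
  have := h.min V' (hf.mono (by
    intro u hu
    have hN := h.nat u hu j
    refine Finset.mem_filter.2 ⟨h.sub hu, ?_, ?_⟩
    · rintro rfl
      exact hn hN
    · intro e
      rw [e, NF_c] at hN
      exact hn hN))
  omega

theorem MinT.card_c {s : Fin 5 → S} {Q V : Finset (Fin 5 → S)} (h : MinT c s Q V)
    {j : Fin 5} {σ : S} (hn : ¬ NF c s j σ) : (sl V j (c σ)).card = (sl V j σ).card := by
  have := card_eq_of_Eqv (h.code.mono (sl_sub _ _ _)) (sh_code h.code j (c σ) σ) (h.slices hn)
  rw [card_sh] at this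
  exact this.symm

theorem MinT.both {s : Fin 5 → S} {Q V : Finset (Fin 5 → S)} (h : MinT c s Q V)
    {j : Fin 5} {σ : S} (hn : ¬ NF c s j σ) (hne : (sl V j σ).Nonempty)
    (P : ∀ (ρ : S) (r : Fin 5 → S), ρ = σ ∨ ρ = c σ → CO r (Finset.univ.erase j) (sl V j ρ) →
      IsCode c (sl V j ρ) → IsCode c (sh (sl V j (c ρ)) j ρ) →
      Eqv c (sl V j ρ) (sh (sl V j (c ρ)) j ρ) → (sl V j ρ).card = (sl V j σ).card →
      GC c (sl V j ρ) (sh (sl V j (c ρ)) j ρ)) : False := by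
  have hO : CO s Finset.univ V := fun w _ i hi => absurd (Finset.mem_univ i) hi
  apply h.notboth hn hne
  · exact P σ _ (Or.inl rfl) (CO_sl hO j σ) (h.code.mono (sl_sub _ _ _)) (sh_code h.code _ _ _)
      (h.slices hn) rfl
  · have := P (c σ) _ (Or.inr rfl) (CO_sl hO j (c σ)) (h.code.mono (sl_sub _ _ _))
      (sh_code h.code _ _ _) (h.slices (fun e => hn (NF_c.1 e))) (h.card_c hn)
    rwa [cc (c := c)] at this

theorem MinT.ten {s : Fin 5 → S} {Q V : Finset (Fin 5 → S)} (h : MinT c s Q V)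
    {j : Fin 5} {w : Fin 5 → S} (hw : w ∈ V) (hn : ¬ NF c s j (w j)) :
    10 ≤ (sl V j (w j)).card := by
  by_contra hlt
  refine h.both hn ⟨w, mem_sl.2 ⟨hw, rfl⟩⟩ ?_
  intro ρ r _ h1 h2 h3 h4 h5
  exact LL4 (Finset.univ.erase j) (by simp) r _ _ h1 h2 h3 h4 (by omega)

theorem MinT.uniq {s : Fin 5 → S} {Q V : Finset (Fin 5 → S)} (h : MinT c s Q V)
    {j : Fin 5} {w w' : Fin 5 → S} (hw : w ∈ V) (hn : ¬ NF c s j (w j))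
    (hw' : w' ∈ V) (hn' : ¬ NF c s j (w' j)) : w' j = w j ∨ w' j = c (w j) := by
  by_contra hne
  push Not at hne
  have a1 := h.ten hw hn
  have a2 := h.card_c hn
  have b1 := h.ten hw' hn'
  have b2 := h.card_c hn'
  have d1 : Disjoint (sl V j (w j)) (sl V j (c (w j))) := sl_disj
  have d2 : Disjoint (sl V j (w' j)) (sl V j (c (w' j))) := sl_disj
  have d3 : Disjoint (sl V j (w j) ∪ sl V j (c (w j))) (sl V j (w' j) ∪ sl V j (c (w' j))) := by
    rw [Finset.disjoint_left]
    intro u h1 h2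
    rw [Finset.mem_union, mem_sl, mem_sl] at h1 h2
    rcases h1 with ⟨_, h1⟩ | ⟨_, h1⟩ <;> rcases h2 with ⟨_, h2⟩ | ⟨_, h2⟩ <;> rw [h1] at h2
    · exact hne.1 h2.symm
    · exact hne.2 (ceq h2)
    · exact hne.2 h2.symm
    · exact hne.1 (cinj h2).symm
  have hs : (sl V j (w j) ∪ sl V j (c (w j))) ∪ (sl V j (w' j) ∪ sl V j (c (w' j))) ⊆ V :=
    Finset.union_subset (Finset.union_subset (sl_sub _ _ _) (sl_sub _ _ _))
      (Finset.union_subset (sl_sub _ _ _) (sl_sub _ _ _))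
  have := Finset.card_le_card hs
  rw [Finset.card_union_of_disjoint d3, Finset.card_union_of_disjoint d1,
    Finset.card_union_of_disjoint d2, h.card] at this
  omega

theorem MinT.every {s : Fin 5 → S} {Q V : Finset (Fin 5 → S)} (h : MinT c s Q V)
    (hf : ∃ w ∈ V, ∃ j, ¬ NF c s j (w j)) (k : Fin 5) : ∃ w ∈ V, ¬ NF c s k (w k) := by
  by_contra hk
  push Not at hk
  obtain ⟨w, hw, j, hj⟩ := hf
  have hkj : k ≠ j := by
    rintro rfl
    exact hj (hk w hw)
  refine h.both hj ⟨w, mem_sl.2 ⟨hw, rfl⟩⟩ ?_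
  intro ρ r _ h1 h2 h3 h4 h5
  refine prod_GC h1 h2 h3 h4 (by simp) (j := k) (by simp [hkj]) (t := s k) ?_ ?_
  · intro u hu
    exact hk u (mem_sl.1 hu).1
  · intro u hu
    obtain ⟨x, hx, rfl⟩ := Finset.mem_image.1 hu
    rw [Function.update_of_ne hkj]
    exact hk x (mem_sl.1 hx).1

theorem MinT.twelve {s : Fin 5 → S} {Q V : Finset (Fin 5 → S)} (h : MinT c s Q V)
    (hf : ∃ w ∈ V, ∃ j, ¬ NF c s j (w j)) (k : Fin 5) :
    (V.filter (fun w => NF c s k (w k))).card ≤ 12 := by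
  obtain ⟨w, hw, hn⟩ := h.every hf k
  have a1 := h.ten hw hn
  have a2 := h.card_c hn
  have d1 : Disjoint (sl V k (w k)) (sl V k (c (w k))) := sl_disj
  have d3 : Disjoint (sl V k (w k) ∪ sl V k (c (w k))) (V.filter (fun w => NF c s k (w k))) := by
    rw [Finset.disjoint_left]
    intro u h1 h2
    rw [Finset.mem_union, mem_sl, mem_sl] at h1
    have h3 := (Finset.mem_filter.1 h2).2
    rcases h1 with ⟨_, h1⟩ | ⟨_, h1⟩ <;> rw [h1] at h3
    · exact hn h3
    · exact hn (NF_c.1 h3)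
  have hs : (sl V k (w k) ∪ sl V k (c (w k))) ∪ (V.filter (fun w => NF c s k (w k))) ⊆ V :=
    Finset.union_subset (Finset.union_subset (sl_sub _ _ _) (sl_sub _ _ _))
      (Finset.filter_subset _ _)
  have := Finset.card_le_card hs
  rw [Finset.card_union_of_disjoint d3, Finset.card_union_of_disjoint d1, h.card] at this
  omega

/-- neighbour of q -/
def ee (c : S → S) (q : Fin d → S) (j : Fin d) : Fin d → S := Function.update q j (c (q j))

/-- number of native letters -/
def ze (c : S → S) (s : Fin d → S) (w : Fin d → S) : ℕ :=
  (Finset.univ.filter (fun i => NF c s i (w i))).card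

theorem NF_q {s q : Fin d → S} (hq : ∀ i, NF c s i (q i)) {i : Fin d} {x : S} :
    NF c s i x ↔ x = q i ∨ x = c (q i) := by
  rcases hq i with h | h
  · rw [h]; rfl
  · rw [h, cc (c := c)]; unfold NF; tauto

theorem mem_Cj {V : Finset (Fin d → S)} (hV : IsCode c V) {q : Fin d → S} (hq : q ∈ V)
    {j : Fin d} {w : Fin d → S} (hw : w ∈ ndw c V (ee c q j)) :
    w j = c (q j) ∧ ∀ i, i ≠ j → w i ≠ c (q i) := by
  obtain ⟨h1, h2⟩ := mem_ndw.1 hw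
  have h3 : ∀ i, i ≠ j → w i ≠ c (q i) := by
    intro i hi e
    exact h2 ⟨i, by rw [ee, Function.update_of_ne hi]; exact e⟩
  refine ⟨?_, h3⟩
  have hne : w ≠ q := by
    rintro rfl
    exact h2 ⟨j, by rw [ee, Function.update_self, cc (c := c)]⟩
  obtain ⟨i, hi⟩ := hV w h1 q hq hne
  by_cases hij : i = j
  · rw [← hij]; exact hi
  · exact absurd hi (h3 i hij)

theorem ze_Cj {V : Finset (Fin d → S)} (hV : IsCode c V) {s q : Fin d → S} (hq : q ∈ V)
    (hN : ∀ i, NF c s i (q i))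
    {j : Fin d} {w : Fin d → S} (hw : w ∈ ndw c V (ee c q j)) : zz (ee c q j) w = ze c s w := by
  obtain ⟨h1, h2⟩ := mem_Cj hV hq hw
  unfold zz ze
  congr 1
  ext i
  simp only [Finset.mem_filter, Finset.mem_univ, true_and]
  rw [NF_q hN]
  by_cases hij : i = j
  · subst hij
    simp [ee, h1]
  · rw [ee, Function.update_of_ne hij]
    simp [h2 i hij]

theorem Cj_disj {V : Finset (Fin d → S)} (hV : IsCode c V) {q : Fin d → S} (hq : q ∈ V)
    {j k : Fin d} {w : Fin d → S} (hw : w ∈ ndw c V (ee c q j)) (hk : w ∈ ndw c V (ee c q k)) :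
    k = j := by
  by_contra h
  exact (mem_Cj hV hq hw).2 k h (mem_Cj hV hq hk).1

theorem q_not_Cj {V : Finset (Fin d → S)} (hV : IsCode c V) {q : Fin d → S} (hq : q ∈ V)
    {j : Fin d} : q ∉ ndw c V (ee c q j) := by
  intro h
  exact cne (c := c) _ (mem_Cj hV hq h).1.symm

/-- indicator -/
def ind (c : S → S) (V : Finset (Fin d → S)) (q w : Fin d → S) (j : Fin d) : ℕ :=
  if w ∈ ndw c V (ee c q j) then 1 else 0

theorem ind_cases {V : Finset (Fin d → S)} (hV : IsCode c V) {s q : Fin d → S} (hq : q ∈ V)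
    (hN : ∀ i, NF c s i (q i)) {w : Fin d → S} (hw : w ∈ V) :
    (w = q ∧ ∑ j, ind c V q w j = 0 ∧ ze c s w = d) ∨ (w ≠ q ∧ ∑ j, ind c V q w j = 1) ∨
    (w ≠ q ∧ ∑ j, ind c V q w j = 0 ∧ 2 ≤ ze c s w) := by
  by_cases h : w = q
  · left
    refine ⟨h, ?_, ?_⟩
    · apply Finset.sum_eq_zero
      intro j _
      subst h
      simp [ind, q_not_Cj hV hq]
    · subst h
      unfold ze
      rw [Finset.filter_true_of_mem (fun i _ => hN i)]
      simp
  · right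
    by_cases h2 : ∃ j, w ∈ ndw c V (ee c q j)
    · left
      obtain ⟨j, hj⟩ := h2
      refine ⟨h, ?_⟩
      rw [Finset.sum_eq_single j]
      · simp [ind, hj]
      · intro k _ hk
        have : w ∉ ndw c V (ee c q k) := fun e => hk (Cj_disj hV hq hj e)
        simp [ind, this]
      · simp
    · right
      push Not at h2
      refine ⟨h, ?_, ?_⟩
      · apply Finset.sum_eq_zero
        intro j _
        simp [ind, h2 j]
      · obtain ⟨i, hi⟩ := hV w hw q hq h
        have h3 : Dich c w (ee c q i) := by
          by_contra e
          exact h2 i (mem_ndw.2 ⟨hw, e⟩)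
        obtain ⟨k, hk⟩ := h3
        have hki : k ≠ i := by
          rintro rfl
          rw [ee, Function.update_self, cc (c := c), hi] at hk
          exact cne (c := c) _ hk
        rw [ee, Function.update_of_ne hki] at hk
        have : ({k, i} : Finset (Fin d)) ⊆ Finset.univ.filter (fun i => NF c s i (w i)) := by
          intro m hm
          rw [Finset.mem_insert, Finset.mem_singleton] at hm
          refine Finset.mem_filter.2 ⟨Finset.mem_univ _, ?_⟩
          rcases hm with rfl | rfl
          · exact (NF_q hN).2 (Or.inr hk)
          · exact (NF_q hN).2 (Or.inr hi)
        have h5 := Finset.card_le_card this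
        rwa [Finset.card_pair hki] at h5

theorem sum_ind {V : Finset (Fin d → S)} {q : Fin d → S} (f : (Fin d → S) → ℕ) :
    ∑ w ∈ V, (∑ j, ind c V q w j) * f w = ∑ j, ∑ w ∈ ndw c V (ee c q j), f w := by
  simp_rw [Finset.sum_mul]
  rw [Finset.sum_comm]
  apply Finset.sum_congr rfl
  intro j _
  rw [← Finset.sum_subset (ndw_sub (c := c) V (ee c q j))]
  · apply Finset.sum_congr rfl
    intro w hw
    simp [ind, hw]
  · intro w _ hw
    simp [ind, hw]

theorem sum_ze {V : Finset (Fin d → S)} {s : Fin d → S} :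
    ∑ w ∈ V, ze c s w = ∑ j, (V.filter (fun w => NF c s j (w j))).card := by
  simp only [ze, Finset.card_filter]
  rw [Finset.sum_comm]

theorem count1 {V : Finset (Fin d → S)} (hV : IsCode c V) {s q : Fin d → S} (hq : q ∈ V)
    (hN : ∀ i, NF c s i (q i)) : ∑ j, (ndw c V (ee c q j)).card + 1 ≤ V.card := by
  have h1 := sum_ind (c := c) (V := V) (q := q) (fun _ => 1)
  simp only [mul_one, ← Finset.card_eq_sum_ones] at h1
  rw [← h1]
  have h2 : ∑ w ∈ V, (if w = q then 1 else 0) = 1 := by simp [hq]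
  rw [← h2, ← Finset.sum_add_distrib, Finset.card_eq_sum_ones]
  apply Finset.sum_le_sum
  intro w hw
  rcases ind_cases hV hq hN hw with ⟨a, b, _⟩ | ⟨a, b⟩ | ⟨a, b, _⟩
  · rw [b, if_pos a]
  · rw [b, if_neg a]
  · rw [b, if_neg a]; omega

theorem count2 {V : Finset (Fin 5 → S)} (hV : IsCode c V) {s q : Fin 5 → S} (hq : q ∈ V)
    (hN : ∀ i, NF c s i (q i)) :
    2 * V.card + 3 + ∑ j, ∑ w ∈ ndw c V (ee c q j), ze c s w ≤
      ∑ w ∈ V, ze c s w + 2 * ∑ j, (ndw c V (ee c q j)).card := by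
  have h1 := sum_ind (c := c) (V := V) (q := q) (fun _ => 1)
  simp only [mul_one, ← Finset.card_eq_sum_ones] at h1
  rw [← h1, ← sum_ind]
  have h2 : ∑ w ∈ V, (if w = q then 3 else 0) = 3 := by simp [hq]
  have h3 : 2 * V.card = ∑ w ∈ V, 2 := by simp [mul_comm]
  rw [h3]
  nth_rw 1 [← h2]
  rw [Finset.mul_sum, ← Finset.sum_add_distrib, ← Finset.sum_add_distrib, ← Finset.sum_add_distrib]
  apply Finset.sum_le_sum
  intro w hw
  rcases ind_cases hV hq hN hw with ⟨a, b, e⟩ | ⟨a, b⟩ | ⟨a, b, e⟩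
  · rw [b, e, if_pos a]; omega
  · rw [b, if_neg a]; omega
  · rw [b, if_neg a]; omega

theorem MinT.notwin {s : Fin 5 → S} {Q V : Finset (Fin 5 → S)} (h : MinT c s Q V)
    {q : Fin 5 → S} (hq : q ∈ V) (hN : ∀ i, NF c s i (q i)) (j : Fin 5) :
    ¬ HasTwin c (ndw c V (ee c q j)) := by
  rintro ⟨w, hw, k, hw'⟩
  have h1 := h.twin (ndw_sub _ _ hw) (ndw_sub _ _ hw')
  obtain ⟨a, b⟩ := mem_Cj h.code hq hw
  obtain ⟨a', b'⟩ := mem_Cj h.code hq hw'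
  by_cases hkj : k = j
  · subst hkj
    rw [Function.update_self, a] at a'
    exact cne (c := c) _ a'
  · rcases (NF_q hN).1 h1 with e | e
    · apply b' k hkj
      rw [Function.update_self, e]
    · exact b k hkj e

theorem MinT.nontriv {s : Fin 5 → S} {Q V : Finset (Fin 5 → S)} (h : MinT c s Q V)
    (hf : ∃ w ∈ V, ∃ j, ¬ NF c s j (w j))
    {q : Fin 5 → S} (hq : q ∈ V) (hN : ∀ i, NF c s i (q i)) (j : Fin 5)
    (hj : (ndw c V (ee c q j)).card ≠ 1) :
    (ndw c V (ee c q j)).card +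
      (Finset.univ.filter (fun i => (ndw c V (ee c q i)).card = 1)).card + 1 ≤ 12 := by
  refine le_trans ?_ (h.twelve hf j)
  have hee : Function.Injective (ee c q) := by
    intro a b hab
    by_contra hne
    have := congrFun hab a
    rw [ee, ee, Function.update_self, Function.update_of_ne hne] at this
    exact cne (c := c) _ this
  have htriv : ∀ i, (ndw c V (ee c q i)).card = 1 → ee c q i ∈ V := by
    intro i hi
    obtain ⟨w, hw⟩ := Finset.card_eq_one.1 hi
    have := (Part_ndw h.code (h.cov (ee c q i))).single hw
    rw [← this]
    exact ndw_sub V (ee c q i) (by rw [hw]; exact Finset.mem_singleton_self w)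
  rw [← Finset.card_image_of_injective _ hee, ← Finset.card_union_of_disjoint,
    ← Finset.card_insert_of_notMem (a := q)]
  · apply Finset.card_le_card
    intro w hw
    rw [Finset.mem_insert, Finset.mem_union, Finset.mem_image] at hw
    refine Finset.mem_filter.2 ?_
    rcases hw with rfl | hw | ⟨i, hi, rfl⟩
    · exact ⟨hq, hN j⟩
    · exact ⟨ndw_sub _ _ hw, (NF_q hN).2 (Or.inr (mem_Cj h.code hq hw).1)⟩
    · refine ⟨htriv i (Finset.mem_filter.1 hi).2, (NF_q hN).2 ?_⟩
      by_cases hij : j = i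
      · subst hij; right; simp [ee]
      · left; simp [ee, hij]
  · rw [Finset.mem_union, Finset.mem_image]
    rintro (e | ⟨i, _, e⟩)
    · exact q_not_Cj h.code hq e
    · have := congrFun e i
      rw [ee, Function.update_self] at this
      exact cne (c := c) _ this
  · rw [Finset.disjoint_left]
    intro w hw hw'
    obtain ⟨i, hi, rfl⟩ := Finset.mem_image.1 hw'
    have hij : j ≠ i := by
      rintro rfl
      exact hj (Finset.mem_filter.1 hi).2
    have := (mem_Cj h.code hq hw).1
    rw [ee, Function.update_of_ne hij] at this
    exact cne (c := c) _ this.symm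

theorem MinT.false {s : Fin 5 → S} {Q V : Finset (Fin 5 → S)} (h : MinT c s Q V)
    (hf : ∃ w ∈ V, ∃ j, ¬ NF c s j (w j)) {q : Fin 5 → S} (hq : q ∈ Q) : False := by
  have hN := h.nat q hq
  have hqV := h.sub hq
  have c1 := count1 h.code hqV hN
  have c2 := count2 h.code hqV hN
  have c3 : ∑ w ∈ V, ze c s w ≤ 60 := by
    rw [sum_ze]
    refine (Finset.sum_le_sum (g := fun _ => 12) (fun j _ => h.twelve hf j)).trans ?_
    simp
  rw [h.card] at c1 c2
  obtain ⟨T, hT⟩ : ∃ T, T = (Finset.univ.filter (fun i => (ndw c V (ee c q i)).card = 1)).card :=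
    ⟨_, rfl⟩
  have key : ∀ j, ((if (ndw c V (ee c q j)).card = 1 then 1 else 0) = 1 ∧
      (ndw c V (ee c q j)).card = 1 ∧ ∑ w ∈ ndw c V (ee c q j), ze c s w = 5) ∨
      ((if (ndw c V (ee c q j)).card = 1 then 1 else 0) = 0 ∧
      (ndw c V (ee c q j)).card + T + 1 ≤ 12 ∧
      (ndw c V (ee c q j)).card + 18 ≤ 2 * ∑ w ∈ ndw c V (ee c q j), ze c s w ∧
      12 ≤ ∑ w ∈ ndw c V (ee c q j), ze c s w) := by
    intro j
    have hP := Part_ndw h.code (h.cov (ee c q j))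
    by_cases h1 : (ndw c V (ee c q j)).card = 1
    · left
      refine ⟨by simp [h1], h1, ?_⟩
      obtain ⟨w, hw⟩ := Finset.card_eq_one.1 h1
      have := hP.single hw
      have hz : ze c s w = 5 := by
        rw [← ze_Cj h.code hqV hN (j := j) (by rw [hw]; exact Finset.mem_singleton_self w), this]
        simp [zz]
      rw [hw, Finset.sum_singleton, hz]
    · right
      have h2 := h.nontriv hf hqV hN j h1
      rw [← hT] at h2
      refine ⟨by simp [h1], h2, ?_⟩
      have hnt := h.notwin hqV hN j
      have h3 := RP hP hnt (j0 := j) (by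
          intro w hw
          rw [(mem_Cj h.code hqV hw).1]; simp [ee]) (by
          have fo : ∀ k, ∀ w ∈ ndw c V (ee c q j), w k ≠ ee c q j k → ¬ NF c s k (w k) := by
            intro k w hw hne hnf
            obtain ⟨a, b⟩ := mem_Cj h.code hqV hw
            by_cases hkj : k = j
            · subst hkj
              apply hne
              rw [a]; simp [ee]
            · rw [ee, Function.update_of_ne hkj] at hne
              rcases (NF_q hN).1 hnf with e | e
              · exact hne e
              · exact b k hkj e
          intro k w hw w' hw' e e'
          exact h.uniq (ndw_sub _ _ hw) (fo k w hw e) (ndw_sub _ _ hw') (fo k w' hw' e'))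
        (hP.five_le hnt h1) (by omega)
      rwa [Finset.sum_congr rfl (fun w hw => ze_Cj h.code hqV hN hw)] at h3
  rw [Finset.card_filter] at hT
  have k0 := key 0
  have k1 := key 1
  have k2 := key 2
  have k3 := key 3
  have k4 := key 4
  rw [Fin.sum_univ_five] at hT c1 
  rw [Fin.sum_univ_five, Fin.sum_univ_five] at c2
  clear key
  generalize (if (ndw c V (ee c q 0)).card = 1 then 1 else 0) = t0 at *
  generalize (if (ndw c V (ee c q 1)).card = 1 then 1 else 0) = t1 at *
  generalize (if (ndw c V (ee c q 2)).card = 1 then 1 else 0) = t2 at *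
  generalize (if (ndw c V (ee c q 3)).card = 1 then 1 else 0) = t3 at *
  generalize (if (ndw c V (ee c q 4)).card = 1 then 1 else 0) = t4 at *
  generalize (ndw c V (ee c q 0)).card = n0 at *
  generalize (ndw c V (ee c q 1)).card = n1 at *
  generalize (ndw c V (ee c q 2)).card = n2 at *
  generalize (ndw c V (ee c q 3)).card = n3 at *
  generalize (ndw c V (ee c q 4)).card = n4 at *
  generalize ∑ w ∈ ndw c V (ee c q 0), ze c s w = z0 at *
  generalize ∑ w ∈ ndw c V (ee c q 1), ze c s w = z1 at *
  generalize ∑ w ∈ ndw c V (ee c q 2), ze c s w = z2 at *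
  generalize ∑ w ∈ ndw c V (ee c q 3), ze c s w = z3 at *
  generalize ∑ w ∈ ndw c V (ee c q 4), ze c s w = z4 at *
  rcases k0 with k0 | k0 <;> rcases k1 with k1 | k1 <;> rcases k2 with k2 | k2 <;>
    rcases k3 with k3 | k3 <;> rcases k4 with k4 | k4 <;> omega

theorem main_aux (V Q U : Finset (Fin 5 → S)) (hV : CubeTiling c V)
    (hQne : Q.Nonempty) (hU : SimpleCubeTiling c U) (hQ : Q = V ∩ U) :
    GCFix c Q V U := by
  classical
  obtain ⟨s, hs⟩ := hU
  obtain ⟨hVc, hV32⟩ := hV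
  have hUeq : U = UJ c s Finset.univ := by
    ext w
    rw [hs, mem_UJ]
    simp
  have hQV : Q ⊆ V := by rw [hQ]; exact Finset.inter_subset_left
  have hQU : Q ⊆ U := by rw [hQ]; exact Finset.inter_subset_right
  have hex : ∃ n, ∃ V', GCFix c Q V V' ∧ Psi (phi c s) V' = n :=
    ⟨_, V, Relation.ReflTransGen.refl, rfl⟩
  obtain ⟨V', hV', hn⟩ := Nat.find_spec hex
  have hmin := fun m => Nat.find_min' hex (m := m)
  have hcode := hV'.gc.code hVc
  have hcard : V'.card = 32 := by
    rw [← card_eq_of_Eqv hVc hcode (hV'.gc.eqv hVc), hV32]; rfl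
  have hM : MinT c s Q V' := by
    refine ⟨hcode, hcard, hV'.sub hQV, ?_, ?_⟩
    · intro w hw i
      exact (hs w).1 (hQU hw) i
    · intro W hW
      rw [hn]
      exact hmin _ ⟨W, hV'.trans hW, rfl⟩
  obtain ⟨q, hq⟩ := hQne
  have hall : ∀ w ∈ V', ∀ j, NF c s j (w j) := by
    by_contra hne
    push Not at hne
    exact hM.false hne hq
  have hsub : V' ⊆ U := fun w hw => (hs w).2 (hall w hw)
  have : V' = U := Finset.eq_of_subset_of_card_le hsub (by
    rw [hUeq, card_UJ, hcard]; rfl)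
  rw [← this]
  exact hV'

end helpers

/-- Theorem "stab5" of the paper. -/
theorem simple_component_fixed_dim5
    {S : Type} [Fintype S] [DecidableEq S] (c : S → S)
    (hc : ∀ s, c (c s) = s) (hc' : ∀ s, c s ≠ s)
    (V Q U : Finset (Fin 5 → S)) (hV : CubeTiling c V)
    (hQne : Q.Nonempty) (hU : SimpleCubeTiling c U) (hQ : Q = V ∩ U) :
    GCFix c Q V U := by
  have : Cpl c := ⟨hc, hc'⟩
  exact main_aux V Q U hV hQne hU hQ

end PolyboxPaper
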